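/- Let k be an algebraically closed field of characteristic p > 0 and R = k[x_0,...,x_n]. Let I ⊆ R be a homogeneous ideal generated by forms of degree d, of height h. Then fpt(I) = h/d if and only if the integral closure of I equals (x_0,...,x_{h-1})^d up to a linear change of coordinates. -/

import Mathlib

open MvPolynomial Filter

noncomputable section

variable {k : Type*} [Field k]

/-- The `q`-th bracket power of an ideal. -/
def frobPow {R : Type*} [CommRing R] (q : ℕ) (I : Ideal R) : Ideal R :=
  Ideal.span ((fun x => x ^ q) '' (I : Set R))

/-- The homogeneous maximal ideal of `k[x_0,…,x_n]`. -/
def maxIdl (n : ℕ) (k : Type*) [Field k] : Ideal (MvPolynomial (Fin (n + 1)) k) :=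
  Ideal.span (Set.range X)

/-- `ν_I(q) = max{r : I^r ⊄ 𝔪^{[q]}}`. -/
def nuFn {n : ℕ} (I : Ideal (MvPolynomial (Fin (n + 1)) k)) (q : ℕ) : ℕ :=
  sSup {r : ℕ | ¬ I ^ r ≤ frobPow q (maxIdl n k)}

/-- The height of an ideal. -/
def idealHeight {R : Type*} [CommRing R] (I : Ideal R) : ℕ∞ :=
  ⨅ (p : PrimeSpectrum R) (_ : I ≤ p.asIdeal), Order.height p

/-- The integral closure of an ideal `I`, as a set. -/
def intCl {R : Type*} [CommRing R] (I : Ideal R) : Set R :=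
  {x | ∃ m : ℕ, 0 < m ∧ ∃ a : ℕ → R,
    (∀ i ∈ Finset.Icc 1 m, a i ∈ I ^ i) ∧
    x ^ m + ∑ i ∈ Finset.Icc 1 m, a i * x ^ (m - i) = 0}

/-- The linear change of coordinates on `k[x_0,…,x_n]` given by a matrix `M`. -/
def coordChange {n : ℕ} (M : Matrix (Fin (n + 1)) (Fin (n + 1)) k) :
    MvPolynomial (Fin (n + 1)) k →ₐ[k] MvPolynomial (Fin (n + 1)) k :=
  aeval fun i => ∑ j, MvPolynomial.C (M i j) * X j

/-- The ideal `(x_0,…,x_{h-1})`. -/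
def varIdeal {n : ℕ} (k : Type*) [Field k] (h : ℕ) :
    Ideal (MvPolynomial (Fin (n + 1)) k) :=
  Ideal.span {f | ∃ i : Fin (n + 1), (i : ℕ) < h ∧ f = X i}

/-- Indicator weight of the first `h` variables. -/
def wt (n h : ℕ) : Fin (n + 1) → ℕ := fun i => if (i : ℕ) < h then 1 else 0

/-- Degree in the first `h` variables. -/
def xdeg {n : ℕ} (h : ℕ) (u : Fin (n + 1) →₀ ℕ) : ℕ := Finsupp.weight (wt n h) u

lemma xdeg_eq {n : ℕ} (h : ℕ) (u : Fin (n + 1) →₀ ℕ) :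
    xdeg h u = ∑ i : Fin (n + 1), if (i : ℕ) < h then u i else 0 := by
  unfold xdeg
  rw [Finsupp.weight_apply, Finsupp.sum_fintype _ _ (by simp)]
  refine Finset.sum_congr rfl fun i _ => ?_
  simp [wt]

lemma xdeg_add {n : ℕ} (h : ℕ) (u v : Fin (n + 1) →₀ ℕ) :
    xdeg h (u + v) = xdeg h u + xdeg h v := by
  simp [xdeg]

/-- weight component -/
def comp {n : ℕ} (h t : ℕ) : MvPolynomial (Fin (n + 1)) k →ₗ[k] MvPolynomial (Fin (n + 1)) k :=
  weightedHomogeneousComponent (wt n h) t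

lemma coeff_comp {n : ℕ} (h t : ℕ) (F : MvPolynomial (Fin (n + 1)) k) (u) :
    coeff u (comp h t F) = if xdeg h u = t then coeff u F else 0 := by
  unfold comp xdeg
  rw [coeff_weightedHomogeneousComponent]

/-- homogeneity for the weight -/
def wHom {n : ℕ} (h : ℕ) (F : MvPolynomial (Fin (n + 1)) k) (t : ℕ) : Prop :=
  ∀ u, coeff u F ≠ 0 → xdeg h u = t

lemma wHom_iff {n : ℕ} (h : ℕ) (F : MvPolynomial (Fin (n + 1)) k) (t : ℕ) :
    wHom h F t ↔ IsWeightedHomogeneous (wt n h) F t := by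
  constructor
  · intro H u hu; exact H u hu
  · intro H u hu; exact H hu

lemma wHom_top_iff {n : ℕ} (F : MvPolynomial (Fin (n + 1)) k) (t : ℕ) :
    wHom (n + 1) F t ↔ F.IsHomogeneous t := by
  rw [wHom_iff]
  have : wt n (n + 1) = 1 := by
    funext i; simp [wt]; omega
  rw [this]; rfl

lemma wHom_comp {n : ℕ} (h t : ℕ) (F : MvPolynomial (Fin (n + 1)) k) : wHom h (comp h t F) t := by
  intro u hu
  rw [coeff_comp] at hu
  by_contra H
  simp [H] at hu

lemma comp_mul {n h t d : ℕ} (g f : MvPolynomial (Fin (n + 1)) k) (hf : wHom h f d) :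
    comp h (t + d) (g * f) = comp h t g * f := by
  induction g using MvPolynomial.induction_on' with
  | add p q hp hq => rw [add_mul, map_add, map_add, add_mul, hp, hq]
  | monomial u a =>
    have hm : IsWeightedHomogeneous (wt n h) (monomial u a) (xdeg h u) :=
      isWeightedHomogeneous_monomial _ _ _ rfl
    have hmf := hm.mul ((wHom_iff _ _ _).1 hf)
    unfold comp
    rw [weightedHomogeneousComponent_of_mem hmf, weightedHomogeneousComponent_of_mem hm]
    by_cases H : t = xdeg h u
    · simp [H]
    · have : ¬ (t + d = xdeg h u + d) := by omega
      simp [H]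

/-- sum of components -/
lemma sum_comp {n : ℕ} (h : ℕ) (F : MvPolynomial (Fin (n + 1)) k) :
    ∃ s : Finset ℕ, F = ∑ t ∈ s, comp h t F := by
  refine ⟨F.support.image (xdeg h), ?_⟩
  ext u
  rw [coeff_sum]
  simp only [coeff_comp]
  rw [Finset.sum_ite_eq]
  split_ifs with H
  · rfl
  · by_contra h0
    exact H (Finset.mem_image.2 ⟨u, mem_support_iff.2 h0, rfl⟩)

/-- polynomials of order at least `s` -/
def ordIdl (n : ℕ) (k : Type*) [Field k] (h s : ℕ) : Ideal (MvPolynomial (Fin (n + 1)) k) where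
  carrier := {F | ∀ u, coeff u F ≠ 0 → s ≤ xdeg h u}
  zero_mem' := by intro u; simp
  add_mem' := by
    intro a b ha hb u hu
    rw [coeff_add] at hu
    by_cases h1 : coeff u a = 0
    · exact hb u (by intro h2; simp [h1, h2] at hu)
    · exact ha u h1
  smul_mem' := by
    intro c x hx u hu
    rw [smul_eq_mul, coeff_mul] at hu
    obtain ⟨⟨a, b⟩, hab, hne⟩ := Finset.exists_ne_zero_of_sum_ne_zero hu
    rw [Finset.HasAntidiagonal.mem_antidiagonal] at hab
    have := hx b (right_ne_zero_of_mul hne)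
    rw [← hab, xdeg_add]; exact le_trans this (Nat.le_add_left _ _)

lemma mem_ordIdl {n h s : ℕ} {F : MvPolynomial (Fin (n + 1)) k} :
    F ∈ ordIdl n k h s ↔ ∀ u, coeff u F ≠ 0 → s ≤ xdeg h u := Iff.rfl

lemma ordIdl_mul_mem {n h s t : ℕ} {F G : MvPolynomial (Fin (n + 1)) k} (hF : F ∈ ordIdl n k h s)
    (hG : G ∈ ordIdl n k h t) : F * G ∈ ordIdl n k h (s + t) := by
  intro u hu
  rw [coeff_mul] at hu
  obtain ⟨⟨a, b⟩, hab, hne⟩ := Finset.exists_ne_zero_of_sum_ne_zero hu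
  rw [Finset.HasAntidiagonal.mem_antidiagonal] at hab
  have h1 := hG b (right_ne_zero_of_mul hne)
  have h2 := hF a (left_ne_zero_of_mul hne)
  rw [← hab, xdeg_add]; exact add_le_add h2 h1

lemma ordIdl_mono {n h s t : ℕ} (hst : s ≤ t) : ordIdl n k h t ≤ ordIdl n k h s :=
  fun _ hF u hu => hst.trans (hF u hu)

lemma X_mem_ordIdl {n h : ℕ} (i : Fin (n + 1)) (hi : (i : ℕ) < h) :
    (X i : MvPolynomial (Fin (n + 1)) k) ∈ ordIdl n k h 1 := by
  intro u hu
  rw [coeff_X] at hu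
  have : Finsupp.single i 1 = u := by by_contra H; simp [H] at hu
  rw [← this]
  simp [xdeg, Finsupp.weight_single, wt, hi]

lemma monomial_mem_varIdeal {n h : ℕ} (u : Fin (n + 1) →₀ ℕ) (a : k) :
    monomial u a ∈ (varIdeal k h : Ideal (MvPolynomial (Fin (n + 1)) k)) ^ (xdeg h u) := by
  rw [monomial_eq, Finsupp.prod_fintype _ _ (by simp), xdeg_eq, ← Finset.prod_pow_eq_pow_sum]
  refine Ideal.mul_mem_left _ _ (Ideal.prod_mem_prod fun i _ => ?_)
  split_ifs with H
  · have hX : (X i : MvPolynomial (Fin (n + 1)) k) ∈ varIdeal k h := Ideal.subset_span ⟨i, H, rfl⟩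
    exact Ideal.pow_mem_pow hX _
  · simp

lemma varIdeal_pow {n : ℕ} (h s : ℕ) :
    (varIdeal k h : Ideal (MvPolynomial (Fin (n + 1)) k)) ^ s = ordIdl n k h s := by
  apply le_antisymm
  · induction s with
    | zero => intro F _ u _; exact Nat.zero_le _
    | succ s ih =>
      rw [pow_succ, Ideal.mul_le]
      intro F hF G hG
      refine ordIdl_mul_mem (ih hF) ?_
      have : varIdeal k h ≤ ordIdl n k h 1 := by
        unfold varIdeal
        rw [Ideal.span_le]
        rintro _ ⟨i, hi, rfl⟩
        exact X_mem_ordIdl i hi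
      exact this hG
  · intro F hF
    rw [F.as_sum]
    refine Ideal.sum_mem _ fun u hu => ?_
    exact Ideal.pow_le_pow_right (hF u (mem_support_iff.1 hu)) (monomial_mem_varIdeal u _)

lemma maxIdl_eq (n : ℕ) : maxIdl n k = varIdeal k (n + 1) := by
  unfold maxIdl varIdeal
  congr 1
  ext f; constructor
  · rintro ⟨i, rfl⟩; exact ⟨i, i.2, rfl⟩
  · rintro ⟨i, _, rfl⟩; exact ⟨i, rfl⟩

lemma comp_mem_ordIdl {n : ℕ} (h t : ℕ) (F : MvPolynomial (Fin (n + 1)) k) :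
    comp h t F ∈ ordIdl n k h t := fun u hu => (wHom_comp h t F u hu).ge

lemma comp_eq_zero {n h s t : ℕ} {F : MvPolynomial (Fin (n + 1)) k} (hF : F ∈ ordIdl n k h s)
    (hts : t < s) : comp h t F = 0 := by
  ext u
  rw [coeff_comp, coeff_zero]
  split_ifs with H
  · by_contra h0
    have := hF u h0
    omega
  · rfl

/-- ideal stable under components -/
def cStable {n : ℕ} (h : ℕ) (Z : Ideal (MvPolynomial (Fin (n + 1)) k)) : Prop :=
  ∀ F ∈ Z, ∀ t, comp h t F ∈ Z

lemma comp_span' {n h d e D : ℕ} {S : Set (MvPolynomial (Fin (n + 1)) k)}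
    (hS : ∀ f ∈ S, wHom h f d) {F : MvPolynomial (Fin (n + 1)) k} (hF : F ∈ Ideal.span S)
    (hD : d + e ≤ D) : ∀ a, comp h D (a * F) ∈ Ideal.span S * ordIdl n k h e := by
  induction hF using Submodule.span_induction with
  | zero => simp
  | add x y _ _ hx hy => intro a; rw [mul_add, map_add]; exact add_mem (hx a) (hy a)
  | mem f hf =>
    intro a
    obtain ⟨t, rfl⟩ : ∃ t, D = t + d := ⟨D - d, by omega⟩
    rw [comp_mul (t := t) a f (hS f hf), mul_comm (comp h t a)]
    refine Ideal.mul_mem_mul (Ideal.subset_span hf) ?_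
    exact ordIdl_mono (t := t) (by omega) (comp_mem_ordIdl h t a)
  | smul b x hx ih =>
    intro a
    rw [smul_eq_mul, ← mul_assoc]
    exact ih _

lemma comp_span {n h d e D : ℕ} {S : Set (MvPolynomial (Fin (n + 1)) k)}
    (hS : ∀ f ∈ S, wHom h f d) {F : MvPolynomial (Fin (n + 1)) k} (hF : F ∈ Ideal.span S)
    (hD : d + e ≤ D) : comp h D F ∈ Ideal.span S * ordIdl n k h e := by
  have := comp_span' hS hF hD 1
  rwa [one_mul] at this

lemma lemmaA {n h d e : ℕ} {S : Set (MvPolynomial (Fin (n + 1)) k)}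
    (hS : ∀ f ∈ S, wHom h f d) {Z : Ideal (MvPolynomial (Fin (n + 1)) k)} (hZ : cStable h Z)
    {F : MvPolynomial (Fin (n + 1)) k} (hF : F ∈ Ideal.span S ⊔ Z)
    (hF2 : F ∈ ordIdl n k h (d + e)) : F ∈ Ideal.span S * ordIdl n k h e ⊔ Z := by
  obtain ⟨s, hs⟩ := sum_comp h F
  rw [hs]
  refine Ideal.sum_mem _ fun D _ => ?_
  by_cases hD : D < d + e
  · rw [comp_eq_zero hF2 hD]; exact zero_mem _
  · obtain ⟨a, ha, z, hz, rfl⟩ := Submodule.mem_sup.1 hF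
    rw [map_add]
    exact Submodule.add_mem_sup (comp_span hS ha (by omega)) (hZ z hz D)

lemma ordIdl_mul {n h s t : ℕ} : ordIdl n k h s * ordIdl n k h t = ordIdl n k h (s + t) := by
  rw [← varIdeal_pow, ← varIdeal_pow, ← varIdeal_pow, pow_add]

lemma lemmaA_pow {n h d N : ℕ} {S : Set (MvPolynomial (Fin (n + 1)) k)}
    (hS : ∀ f ∈ S, wHom h f d) {Z : Ideal (MvPolynomial (Fin (n + 1)) k)} (hZ : cStable h Z)
    (hN : ordIdl n k h N ≤ Ideal.span S ⊔ Z) (r : ℕ) :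
    ordIdl n k h (N + d * r) ≤ (Ideal.span S) ^ r * ordIdl n k h N ⊔ Z := by
  have key : ordIdl n k h (d + N) ≤ Ideal.span S * ordIdl n k h N ⊔ Z := by
    intro F hF
    exact lemmaA hS hZ (hN (ordIdl_mono (by omega) hF)) hF
  induction r with
  | zero => simp
  | succ r ih =>
    have : N + d * (r + 1) = (N + d * r) + d := by ring
    rw [this, ← ordIdl_mul]
    calc _ ≤ ((Ideal.span S) ^ r * ordIdl n k h N ⊔ Z) * ordIdl n k h d := Ideal.mul_mono_left ih
      _ = (Ideal.span S) ^ r * ordIdl n k h (d + N) ⊔ Z * ordIdl n k h d := by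
        rw [Ideal.sup_mul, mul_assoc, ordIdl_mul, add_comm N d]
      _ ≤ (Ideal.span S) ^ r * (Ideal.span S * ordIdl n k h N ⊔ Z) ⊔ Z :=
        sup_le_sup (Ideal.mul_mono_right key) Ideal.mul_le_left
      _ ≤ _ := by
        rw [Ideal.mul_sup, ← mul_assoc, ← pow_succ, sup_assoc]
        exact sup_le_sup le_rfl (sup_le Ideal.mul_le_right le_rfl)

lemma cStable_bot {n h : ℕ} : cStable h (⊥ : Ideal (MvPolynomial (Fin (n + 1)) k)) := by
  intro F hF t
  rw [Ideal.mem_bot] at hF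
  simp [hF]

lemma comp_of_wHom {n h s t : ℕ} {F : MvPolynomial (Fin (n + 1)) k} (hF : wHom h F s) :
    comp h t F = if t = s then F else 0 := by
  unfold comp
  rw [weightedHomogeneousComponent_of_mem ((wHom_iff _ _ _).1 hF)]

lemma wHom_mul {n h s t : ℕ} {F G : MvPolynomial (Fin (n + 1)) k} (hF : wHom h F s)
    (hG : wHom h G t) : wHom h (F * G) (s + t) := by
  rw [wHom_iff] at *
  exact hF.mul hG

lemma cStable_mul {n h : ℕ} {A B : Ideal (MvPolynomial (Fin (n + 1)) k)} (hA : cStable h A)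
    (hB : cStable h B) : cStable h (A * B) := by
  intro F hF t
  induction hF using Submodule.mul_induction_on' with
  | add x _ y _ hx hy => rw [map_add]; exact add_mem hx hy
  | mem_mul_mem a ha b hb =>
    obtain ⟨s, hs⟩ := sum_comp h a
    obtain ⟨s', hs'⟩ := sum_comp h b
    have : a * b = ∑ i ∈ s, ∑ j ∈ s', comp h i a * comp h j b := by
      rw [← Finset.sum_mul_sum, ← hs, ← hs']
    rw [this, map_sum]
    refine Ideal.sum_mem _ fun i _ => ?_
    rw [map_sum]
    refine Ideal.sum_mem _ fun j _ => ?_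
    rw [comp_of_wHom (wHom_mul (wHom_comp h i a) (wHom_comp h j b))]
    split_ifs
    · exact Ideal.mul_mem_mul (hA a ha i) (hB b hb j)
    · exact zero_mem _

lemma cStable_pow {n h : ℕ} {A : Ideal (MvPolynomial (Fin (n + 1)) k)} (hA : cStable h A) (r : ℕ) :
    cStable h (A ^ r) := by
  induction r with
  | zero => intro F _ t; simp
  | succ r ih => rw [pow_succ]; exact cStable_mul ih hA

lemma cStable_span {n h d : ℕ} {S : Set (MvPolynomial (Fin (n + 1)) k)}
    (hS : ∀ f ∈ S, wHom h f d) : cStable h (Ideal.span S) := by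
  have aux : ∀ F ∈ Ideal.span S, F ∈ ordIdl n k h d := by
    intro F hF
    have : Ideal.span S ≤ ordIdl n k h d := by
      rw [Ideal.span_le]; intro f hf u hu; exact (hS f hf u hu).ge
    exact this hF
  intro F hF t
  by_cases ht : t < d
  · rw [comp_eq_zero (aux F hF) ht]; exact zero_mem _
  · exact Ideal.mul_le_left (comp_span (e := 0) hS hF (by omega))

/-- the ideal of the last variables -/
def zIdeal (n : ℕ) (k : Type*) [Field k] (h : ℕ) : Ideal (MvPolynomial (Fin (n + 1)) k) :=
  Ideal.span (X '' {i : Fin (n + 1) | h ≤ (i : ℕ)})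

lemma mem_zIdeal {n h : ℕ} {F : MvPolynomial (Fin (n + 1)) k} :
    F ∈ zIdeal n k h ↔ ∀ u, coeff u F ≠ 0 → ∃ i : Fin (n + 1), h ≤ (i : ℕ) ∧ u i ≠ 0 := by
  unfold zIdeal
  rw [mem_ideal_span_X_image]
  simp

lemma cStable_zIdeal {n h h' : ℕ} : cStable h' (zIdeal n k h) := by
  intro F hF t
  rw [mem_zIdeal] at *
  intro u hu
  apply hF u
  rw [coeff_comp] at hu
  intro h0
  simp [h0] at hu

lemma ordIdl_ne_of_wHom {n h s : ℕ} {F : MvPolynomial (Fin (n + 1)) k} (hF : wHom h F s)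
    (hF2 : F ∈ ordIdl n k h (s + 1)) : F = 0 := by
  ext u
  by_contra h0
  have h1 := hF u h0
  have h2 := hF2 u h0
  omega

lemma exists_lowest {n h d : ℕ} {F : MvPolynomial (Fin (n + 1)) k} (hF : F ∉ ordIdl n k h d) :
    ∃ s < d, F ∈ ordIdl n k h s ∧ comp h s F ≠ 0 ∧ F - comp h s F ∈ ordIdl n k h (s + 1) := by
  classical
  have h0 : F ∈ ordIdl n k h 0 := fun u _ => Nat.zero_le _
  have hex : ∃ s, F ∉ ordIdl n k h s := ⟨d, hF⟩
  set t := Nat.find hex with ht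
  have h1 : F ∉ ordIdl n k h t := Nat.find_spec hex
  have ht0 : t ≠ 0 := by intro h; rw [h] at h1; exact h1 h0
  obtain ⟨s, hs⟩ : ∃ s, t = s + 1 := ⟨t - 1, by omega⟩
  have h2 : F ∈ ordIdl n k h s := by
    by_contra H
    exact Nat.find_min hex (m := s) (by omega) H
  have h3 : F - comp h s F ∈ ordIdl n k h (s + 1) := by
    intro u hu
    rw [coeff_sub, coeff_comp] at hu
    split_ifs at hu with H
    · simp at hu
    · have := h2 u (by simpa using hu)
      omega
  refine ⟨s, ?_, h2, ?_, h3⟩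
  · have : t ≤ d := Nat.find_min' hex hF
    omega
  · intro H
    rw [H, sub_zero, ← hs] at h3
    exact h1 h3

lemma ordIdl_pow_mem {n h s m : ℕ} {F : MvPolynomial (Fin (n + 1)) k} (hF : F ∈ ordIdl n k h s) :
    F ^ m ∈ ordIdl n k h (s * m) := by
  rw [← varIdeal_pow, pow_mul, varIdeal_pow]
  exact Ideal.pow_mem_pow hF m

lemma wHom_pow {n h s : ℕ} {F : MvPolynomial (Fin (n + 1)) k} (hF : wHom h F s) (m : ℕ) :
    wHom h (F ^ m) (s * m) := by
  rw [wHom_iff] at *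
  have := hF.pow m
  rwa [smul_eq_mul, mul_comm] at this

/-- `J^d` is integrally closed. -/
lemma intCl_subset {n h d : ℕ} {I : Ideal (MvPolynomial (Fin (n + 1)) k)}
    (hI : I ≤ ordIdl n k h d) : intCl I ⊆ (ordIdl n k h d : Set (MvPolynomial (Fin (n + 1)) k)) := by
  rintro F ⟨m, hm, a, ha, heq⟩
  by_contra hF
  obtain ⟨s, hs, h1, h2, h3⟩ := exists_lowest hF
  have h4 : F ^ m ∈ ordIdl n k h (s * m + 1) := by
    have : F ^ m = - ∑ i ∈ Finset.Icc 1 m, a i * F ^ (m - i) := by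
      linear_combination heq
    rw [this]
    refine neg_mem (Ideal.sum_mem _ fun i hi => ?_)
    rw [Finset.mem_Icc] at hi
    have h5 : a i ∈ ordIdl n k h (d * i) := by
      have := Ideal.pow_right_mono hI i (ha i (Finset.mem_Icc.2 hi))
      rwa [← varIdeal_pow, ← pow_mul, varIdeal_pow] at this
    refine ordIdl_mono ?_ (ordIdl_mul_mem h5 (ordIdl_pow_mem (m := m - i) h1))
    obtain ⟨j, rfl⟩ : ∃ j, m = i + j := ⟨m - i, by omega⟩
    have : i + j - i = j := by omega
    rw [this]
    nlinarith
  have h5 : ∀ m, F ^ m - (comp h s F) ^ m ∈ ordIdl n k h (s * m + 1) := by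
    intro m
    induction m with
    | zero => simp
    | succ m ih =>
      have : F ^ (m + 1) - (comp h s F) ^ (m + 1) =
        (F ^ m - (comp h s F) ^ m) * F + (comp h s F) ^ m * (F - comp h s F) := by ring
      rw [this]
      refine add_mem ?_ ?_
      · refine ordIdl_mono ?_ (ordIdl_mul_mem ih h1)
        apply le_of_eq; ring
      · refine ordIdl_mono ?_ (ordIdl_mul_mem (ordIdl_pow_mem (m := m) (comp_mem_ordIdl h s F)) h3)
        apply le_of_eq; ring
  have h6 : (comp h s F) ^ m ∈ ordIdl n k h (s * m + 1) := by
    have := sub_mem h4 (h5 m)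
    simpa using this
  exact h2 (pow_eq_zero_iff (by omega) |>.1 (ordIdl_ne_of_wHom (wHom_pow (wHom_comp h s F) m) h6))

lemma coordChange_X {n : ℕ} (M : Matrix (Fin (n + 1)) (Fin (n + 1)) k) (i) :
    coordChange M (X i) = ∑ j, MvPolynomial.C (M i j) * X j := by
  simp [coordChange]

lemma coordChange_comp {n : ℕ} (M N : Matrix (Fin (n + 1)) (Fin (n + 1)) k) (F) :
    coordChange M (coordChange N F) = coordChange (N * M) F := by
  have : (coordChange M).comp (coordChange N) = coordChange (N * M) := by
    apply MvPolynomial.algHom_ext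
    intro i
    simp only [AlgHom.comp_apply, coordChange_X, map_sum, map_mul, Matrix.mul_apply]
    simp only [Finset.sum_mul, Finset.mul_sum]
    rw [Finset.sum_comm]
    refine Finset.sum_congr rfl fun l _ => Finset.sum_congr rfl fun j _ => ?_
    rw [← MvPolynomial.algebraMap_eq, AlgHom.commutes]
    ring
  rw [← this]; rfl

lemma coordChange_one {n : ℕ} (F) :
    coordChange (1 : Matrix (Fin (n + 1)) (Fin (n + 1)) k) F = F := by
  have : coordChange (1 : Matrix (Fin (n + 1)) (Fin (n + 1)) k) = AlgHom.id k _ := by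
    apply MvPolynomial.algHom_ext
    intro i
    rw [coordChange_X]
    simp [Matrix.one_apply, Finset.sum_ite_eq]
  rw [this]; rfl

/-- coordinate change as an equivalence -/
def coordEquiv {n : ℕ} (M : Matrix (Fin (n + 1)) (Fin (n + 1)) k) (hM : IsUnit M.det) :
    MvPolynomial (Fin (n + 1)) k ≃ₐ[k] MvPolynomial (Fin (n + 1)) k :=
  AlgEquiv.ofAlgHom (coordChange M) (coordChange M⁻¹)
    (by ext1 i; simp only [AlgHom.comp_apply]; rw [coordChange_comp, Matrix.nonsing_inv_mul _ hM, coordChange_one]; rfl)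
    (by ext1 i; simp only [AlgHom.comp_apply]; rw [coordChange_comp, Matrix.mul_nonsing_inv _ hM, coordChange_one]; rfl)

lemma coordEquiv_apply {n : ℕ} (M : Matrix (Fin (n + 1)) (Fin (n + 1)) k) (hM : IsUnit M.det) (F) :
    coordEquiv M hM F = coordChange M F := rfl

lemma aeval_coordChange {n : ℕ} (M : Matrix (Fin (n + 1)) (Fin (n + 1)) k) (F) (v : Fin (n + 1) → k) :
    eval v (coordChange M F) = eval (M.mulVec v) F := by
  have : (aeval v : _ →ₐ[k] k).comp (coordChange M) = aeval (M.mulVec v) := by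
    apply MvPolynomial.algHom_ext
    intro i
    simp only [AlgHom.comp_apply, coordChange_X, map_sum, map_mul, aeval_X, Matrix.mulVec, dotProduct]
    simp
  have h2 := DFunLike.congr_fun this F
  simpa [aeval_eq_eval] using h2

lemma coordChange_homog {n D : ℕ} (M : Matrix (Fin (n + 1)) (Fin (n + 1)) k)
    {F : MvPolynomial (Fin (n + 1)) k} (hF : F.IsHomogeneous D) :
    (coordChange M F).IsHomogeneous D := by
  have := hF.aeval (fun i => ∑ j, MvPolynomial.C (M i j) * X j) (n := 1) (fun i => by
    refine IsHomogeneous.sum _ _ _ fun j _ => ?_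
    exact (isHomogeneous_X k j).C_mul _)
  simpa [coordChange] using this

lemma map_maxIdl {n : ℕ} (M : Matrix (Fin (n + 1)) (Fin (n + 1)) k) (hM : IsUnit M.det) :
    (maxIdl n k).map (coordChange M) = maxIdl n k := by
  have key : ∀ M : Matrix (Fin (n + 1)) (Fin (n + 1)) k,
      (maxIdl n k).map (coordChange M) ≤ maxIdl n k := by
    intro M
    unfold maxIdl
    rw [Ideal.map_span, Ideal.span_le]
    rintro _ ⟨_, ⟨i, rfl⟩, rfl⟩
    rw [coordChange_X]
    exact Ideal.sum_mem _ fun j _ => Ideal.mul_mem_left _ _ (Ideal.subset_span ⟨j, rfl⟩)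
  apply le_antisymm (key M)
  intro F hF
  have h1 := key M⁻¹ (Ideal.mem_map_of_mem (coordChange M⁻¹) hF)
  have h2 := Ideal.mem_map_of_mem (coordChange M) h1
  rwa [coordChange_comp, Matrix.nonsing_inv_mul _ hM, coordChange_one] at h2

lemma mem_map_coord {n : ℕ} (M : Matrix (Fin (n + 1)) (Fin (n + 1)) k) (hM : IsUnit M.det)
    (I : Ideal (MvPolynomial (Fin (n + 1)) k)) (F) :
    coordChange M F ∈ I.map (coordChange M) ↔ F ∈ I := by
  constructor
  · intro h
    have h2 := Ideal.mem_map_of_mem (coordChange M⁻¹) h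
    rw [coordChange_comp, Matrix.mul_nonsing_inv _ hM, coordChange_one] at h2
    have h3 : Ideal.map (coordChange M⁻¹) (Ideal.map (coordChange M) I) ≤ I := by
      rw [Ideal.map_le_iff_le_comap, Ideal.map_le_iff_le_comap]
      intro x hx
      rw [Ideal.mem_comap, Ideal.mem_comap, coordChange_comp, Matrix.mul_nonsing_inv _ hM,
        coordChange_one]
      exact hx
    exact h3 h2
  · exact Ideal.mem_map_of_mem _

lemma map_coord_le_iff {n : ℕ} (M : Matrix (Fin (n + 1)) (Fin (n + 1)) k) (hM : IsUnit M.det)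
    (I J : Ideal (MvPolynomial (Fin (n + 1)) k)) :
    I.map (coordChange M) ≤ J.map (coordChange M) ↔ I ≤ J := by
  constructor
  · intro h F hF
    rw [← mem_map_coord M hM]
    exact h (Ideal.mem_map_of_mem _ hF)
  · exact Ideal.map_mono

lemma map_frobPow {n : ℕ} (M : Matrix (Fin (n + 1)) (Fin (n + 1)) k) (hM : IsUnit M.det) (q : ℕ) :
    (frobPow q (maxIdl n k)).map (coordChange M) = frobPow q (maxIdl n k) := by
  unfold frobPow
  rw [Ideal.map_span]
  congr 1
  ext F
  constructor
  · rintro ⟨_, ⟨G, hG, rfl⟩, rfl⟩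
    refine ⟨coordChange M G, ?_, by simp⟩
    have := Ideal.mem_map_of_mem (coordChange M) hG
    rwa [map_maxIdl M hM] at this
  · rintro ⟨G, hG, rfl⟩
    refine ⟨(coordChange M⁻¹ G) ^ q, ⟨coordChange M⁻¹ G, ?_, rfl⟩, ?_⟩
    · have := Ideal.mem_map_of_mem (coordChange M⁻¹) hG
      rwa [map_maxIdl M⁻¹ (by rw [Matrix.det_nonsing_inv]; exact hM.ringInverse)] at this
    · rw [map_pow, coordChange_comp, Matrix.nonsing_inv_mul _ hM, coordChange_one]

lemma nuFn_map {n : ℕ} (M : Matrix (Fin (n + 1)) (Fin (n + 1)) k) (hM : IsUnit M.det) (q : ℕ)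
    (I : Ideal (MvPolynomial (Fin (n + 1)) k)) : nuFn (I.map (coordChange M)) q = nuFn I q := by
  unfold nuFn
  congr 1
  ext r
  simp only [Set.mem_ofPred_eq]
  rw [← map_coord_le_iff M hM (I ^ r), map_frobPow M hM, Ideal.map_pow]

/-! ### bounds for nu -/

lemma ordIdl_le_frobPow {n : ℕ} (h q : ℕ) :
    ordIdl n k h (h * q + 1) ≤ frobPow q (maxIdl n k) := by
  intro F hF
  rw [F.as_sum]
  refine Ideal.sum_mem _ fun u hu => ?_
  have h1 := hF u (mem_support_iff.1 hu)
  obtain ⟨i, hi⟩ : ∃ i, q ≤ u i := by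
    by_contra! H
    have h2 : xdeg h u ≤ h * q := by
      rw [xdeg_eq]
      have h3 : ∀ i ∈ (Finset.univ : Finset (Fin (n + 1))), (if (i : ℕ) < h then u i else 0) ≤ if (i : ℕ) < h then q else 0 := by
        intro i _
        split_ifs
        · exact (H i).le
        · exact le_rfl
      refine (Finset.sum_le_sum h3).trans ?_
      rw [← Finset.sum_filter, Finset.sum_const, smul_eq_mul]
      refine Nat.mul_le_mul_right _ ?_
      have := Finset.card_le_card_of_injOn (s := Finset.filter (fun i : Fin (n + 1) => (i : ℕ) < h) Finset.univ) (t := Finset.range h) (fun i => (i : ℕ)) (by intro i; simp) (by intro a _ b _ h; exact Fin.ext h)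
      simpa using this
    omega
  have h4 : monomial u (coeff u F) = monomial (u - Finsupp.single i q) (coeff u F) * X i ^ q := by
    rw [X_pow_eq_monomial, monomial_mul, mul_one]
    congr 2
    rw [tsub_add_cancel_of_le]
    exact Finsupp.single_le_iff.2 hi
  rw [h4]
  refine Ideal.mul_mem_left _ _ (Ideal.subset_span ⟨X i, Ideal.subset_span ⟨i, rfl⟩, rfl⟩)

lemma nu_le {n d h q : ℕ} {I : Ideal (MvPolynomial (Fin (n + 1)) k)} (hI : I ≤ ordIdl n k h d)
    {r : ℕ} (hr : ¬ I ^ r ≤ frobPow q (maxIdl n k)) : d * r ≤ h * q := by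
  by_contra H
  apply hr
  have h1 := Ideal.pow_right_mono hI r
  rw [← varIdeal_pow, ← pow_mul, varIdeal_pow] at h1
  exact h1.trans ((ordIdl_mono (by omega)).trans (ordIdl_le_frobPow h q))

lemma nu_bdd {n d h q : ℕ} {I : Ideal (MvPolynomial (Fin (n + 1)) k)} (hI : I ≤ ordIdl n k h d)
    (hd : 0 < d) : BddAbove {r : ℕ | ¬ I ^ r ≤ frobPow q (maxIdl n k)} := by
  refine ⟨h * q, fun r hr => ?_⟩
  have := nu_le hI hr
  nlinarith

lemma nuFn_le {n d h q : ℕ} {I : Ideal (MvPolynomial (Fin (n + 1)) k)} (hI : I ≤ ordIdl n k h d)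
    (hd : 0 < d) : d * nuFn I q ≤ h * q := by
  by_cases hne : {r : ℕ | ¬ I ^ r ≤ frobPow q (maxIdl n k)}.Nonempty
  · exact nu_le hI (Nat.sSup_mem hne (nu_bdd hI hd))
  · rw [Set.not_nonempty_iff_eq_empty] at hne
    unfold nuFn
    rw [hne]; simp

lemma le_nuFn {n d h q : ℕ} {I : Ideal (MvPolynomial (Fin (n + 1)) k)} (hI : I ≤ ordIdl n k h d)
    (hd : 0 < d) {r : ℕ} (hr : ¬ I ^ r ≤ frobPow q (maxIdl n k)) : r ≤ nuFn I q :=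
  le_csSup (nu_bdd hI hd) hr

lemma frobPow_le {n p : ℕ} (hp : p.Prime) [CharP k p] (e : ℕ) :
    frobPow (p ^ e) (maxIdl n k) ≤
      Ideal.span ((fun s => monomial s (1 : k)) '' (Set.range fun i : Fin (n + 1) => Finsupp.single i (p ^ e))) := by
  have : Fact p.Prime := ⟨hp⟩
  unfold frobPow
  rw [Ideal.span_le]
  rintro _ ⟨F, hF, rfl⟩
  simp only [SetLike.mem_coe] at *
  unfold maxIdl at hF
  induction hF using Submodule.span_induction with
  | mem x hx =>
    obtain ⟨i, rfl⟩ := hx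
    rw [X_pow_eq_monomial]
    exact Ideal.subset_span ⟨_, ⟨i, rfl⟩, rfl⟩
  | zero => rw [zero_pow (pow_ne_zero _ hp.ne_zero)]; exact zero_mem _
  | add x y _ _ hx hy => rw [add_pow_char_pow]; exact add_mem hx hy
  | smul a x _ hx => rw [smul_eq_mul, mul_pow]; exact Ideal.mul_mem_left _ _ hx

lemma not_mem_frobPow {n p : ℕ} (hp : p.Prime) [CharP k p] (e : ℕ)
    {F : MvPolynomial (Fin (n + 1)) k} {u} (hu : coeff u F ≠ 0) (hu2 : ∀ i, u i < p ^ e) :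
    F ∉ frobPow (p ^ e) (maxIdl n k) := by
  intro hF
  have h1 := frobPow_le hp e hF
  rw [mem_ideal_span_monomial_image] at h1
  obtain ⟨_, ⟨i, rfl⟩, h2⟩ := h1 u (mem_support_iff.2 hu)
  have := Finsupp.single_le_iff.1 h2
  exact absurd (hu2 i) (by omega)

/-- The consequence of `fpt(I) = h/d`. -/
def hypU {n : ℕ} (d h : ℕ) (I : Ideal (MvPolynomial (Fin (n + 1)) k)) (ord : MonomialOrder (Fin (n + 1))) : Prop :=
  ∀ (r T : ℕ) (F : MvPolynomial (Fin (n + 1)) k), F ∈ I ^ r → F ≠ 0 →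
    (∀ i, ord.degree F i ≤ T) → r * d ≤ h * T

lemma hypU_of {n d h p : ℕ} (hp : p.Prime) [CharP k p]
    (I : Ideal (MvPolynomial (Fin (n + 1)) k)) (hd : 0 < d) (hI : I ≤ ordIdl n k (n + 1) d)
    (hfpt : Tendsto (fun e : ℕ => (nuFn I (p ^ e) : ℝ) / (p : ℝ) ^ e) atTop (nhds ((h : ℝ) / d)))
    (ord : MonomialOrder (Fin (n + 1))) : hypU d h I ord := by
  intro r T F hF hF0 hT
  have hc : coeff (ord.degree F) F ≠ 0 := by rwa [ord.coeff_degree_ne_zero_iff]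
  rcases Nat.eq_zero_or_pos T with rfl | hTpos
  · have h1 := Ideal.pow_right_mono hI r hF
    rw [← varIdeal_pow, ← pow_mul, varIdeal_pow] at h1
    have h2 := h1 _ hc
    have h3 : ord.degree F = 0 := by ext i; simpa using hT i
    rw [h3] at h2
    simp [xdeg] at h2
    rcases h2 with rfl | rfl <;> simp
  · have key : ∀ e : ℕ, (r : ℝ) ≤ T * ((nuFn I (p ^ e) : ℝ) / (p : ℝ) ^ e) + r * T * ((p : ℝ)⁻¹) ^ e := by
      intro e
      have hq : 0 < p ^ e := pow_pos hp.pos _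
      set j := (p ^ e - 1) / T with hj
      have h1 : p ^ e - 1 < T * (j + 1) := by
        have := Nat.lt_mul_div_succ (p ^ e - 1) hTpos
        simpa [hj] using this
      have h2 : j * T ≤ p ^ e - 1 := Nat.div_mul_le_self _ _
      have h3 : r * j ≤ nuFn I (p ^ e) := by
        refine le_nuFn hI hd (fun hle => ?_)
        have h4 : F ^ j ∈ I ^ (r * j) := by rw [pow_mul]; exact Ideal.pow_mem_pow hF j
        refine not_mem_frobPow hp e (F := F ^ j) (u := ord.degree (F ^ j)) ?_ ?_ (hle h4)
        · rw [ord.coeff_degree_ne_zero_iff]; exact pow_ne_zero _ hF0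
        · intro i
          rw [ord.degree_pow]
          have := Nat.mul_le_mul_left j (hT i)
          simp only [Finsupp.smul_apply, smul_eq_mul]
          omega
      have h5 : p ^ e ≤ T * (j + 1) := by omega
      have h6 : (r * p ^ e : ℝ) ≤ T * nuFn I (p ^ e) + r * T := by
        have : r * p ^ e ≤ T * nuFn I (p ^ e) + r * T := by
          calc r * p ^ e ≤ r * (T * (j + 1)) := Nat.mul_le_mul_left _ h5
            _ = T * (r * j) + r * T := by ring
            _ ≤ _ := by gcongr
        exact_mod_cast this
      have hq' : (0 : ℝ) < (p : ℝ) ^ e := by exact_mod_cast hq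
      rw [inv_pow]
      rw [show (T : ℝ) * ((nuFn I (p ^ e) : ℝ) / (p : ℝ) ^ e) + r * T * ((p : ℝ) ^ e)⁻¹
        = (T * nuFn I (p ^ e) + r * T) / (p : ℝ) ^ e by field_simp]
      rw [le_div_iff₀ hq']
      exact h6
    have hlim : Tendsto (fun e : ℕ => (T : ℝ) * ((nuFn I (p ^ e) : ℝ) / (p : ℝ) ^ e) + r * T * ((p : ℝ)⁻¹) ^ e)
        atTop (nhds (T * ((h : ℝ) / d) + r * T * 0)) := by
      refine (hfpt.const_mul _).add (Tendsto.const_mul _ ?_)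
      refine tendsto_pow_atTop_nhds_zero_of_lt_one (by positivity) ?_
      exact inv_lt_one_of_one_lt₀ (by exact_mod_cast hp.one_lt)
    have := ge_of_tendsto' hlim key
    rw [mul_zero, add_zero] at this
    have hd' : (0 : ℝ) < d := by exact_mod_cast hd
    have h7 : (r * d : ℝ) ≤ h * T := by
      rw [← mul_div_assoc, le_div_iff₀ hd'] at this
      linarith
    exact_mod_cast h7

lemma xdeg_le_top {n h : ℕ} (u : Fin (n + 1) →₀ ℕ) : xdeg h u ≤ xdeg (n + 1) u := by
  rw [xdeg_eq, xdeg_eq]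
  refine Finset.sum_le_sum fun i _ => ?_
  have := i.2
  split_ifs <;> omega

lemma wHom_of_mem {n h d : ℕ} {f : MvPolynomial (Fin (n + 1)) k} (hf : wHom (n + 1) f d)
    (hf2 : f ∈ ordIdl n k h d) : wHom h f d := by
  intro u hu
  have h1 := hf u hu
  have h2 := hf2 u hu
  have h3 := xdeg_le_top (h := h) u
  omega

lemma subset_intCl {R : Type*} [CommRing R] (I : Ideal R) : (I : Set R) ⊆ intCl I := by
  intro x hx
  refine ⟨1, one_pos, fun _ => -x, ?_, ?_⟩
  · intro i hi
    have : i = 1 := by simpa using hi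
    subst this
    simpa using hx
  · simp

lemma intCl_pow_mem {R : Type*} [CommRing R] {I : Ideal R} {x : R} (hx : x ∈ intCl I) :
    ∃ m, 0 < m ∧ x ^ m ∈ I := by
  obtain ⟨m, hm, a, ha, heq⟩ := hx
  refine ⟨m, hm, ?_⟩
  have : x ^ m = - ∑ i ∈ Finset.Icc 1 m, a i * x ^ (m - i) := by
    linear_combination heq
  rw [this]
  refine neg_mem (Ideal.sum_mem _ fun i hi => ?_)
  refine Ideal.mul_mem_right _ _ ?_
  rw [Finset.mem_Icc] at hi
  exact Ideal.pow_le_self (by omega) (ha i (Finset.mem_Icc.2 hi))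

lemma not_le_frobPow {n h q p e N d r : ℕ} (hp : p.Prime) [CharP k p] (hn : h ≤ n + 1)
    (hq : q + 1 = p ^ e) 
    {I : Ideal (MvPolynomial (Fin (n + 1)) k)} (hI : ordIdl n k h (N + d * r) ≤ I ^ r)
    (hr : N + d * r ≤ h * q) : ¬ I ^ r ≤ frobPow (p ^ e) (maxIdl n k) := by
  intro hle
  let u : Fin (n + 1) →₀ ℕ := Finsupp.equivFunOnFinite.symm fun i => if (i : ℕ) < h then q else 0
  have hu : xdeg h u = h * q := by
    rw [xdeg_eq]
    have : ∀ i ∈ (Finset.univ : Finset (Fin (n + 1))), (if (i : ℕ) < h then u i else 0) = if (i : ℕ) < h then q else 0 := by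
      intro i _
      by_cases hi : (i : ℕ) < h <;> simp [u, hi]
    rw [Finset.sum_congr rfl this, Fin.sum_univ_eq_sum_range (fun i => if i < h then q else 0),
      ← Finset.sum_filter, Finset.sum_const, smul_eq_mul]
    congr 1
    have : Finset.filter (fun i => i < h) (Finset.range (n + 1)) = Finset.range h := by
      ext i; simp; omega
    rw [this, Finset.card_range]
  refine not_mem_frobPow hp e (F := monomial u (1 : k)) (u := u) (by simp) ?_ (hle (hI ?_))
  · intro i
    have : u i ≤ q := by
      by_cases hi : (i : ℕ) < h <;> simp [u, hi]
    omega
  · intro v hv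
    rw [coeff_monomial] at hv
    have : u = v := by by_contra H; simp [H] at hv
    rw [← this, hu]; exact hr

lemma backward {n d h p : ℕ} (hp : p.Prime) [CharP k p]
    (I : Ideal (MvPolynomial (Fin (n + 1)) k))
    (S : Set (MvPolynomial (Fin (n + 1)) k)) (hgen : I = Ideal.span S)
    (hhom : ∀ f ∈ S, f.IsHomogeneous d) (hd : 0 < d) (hn : h ≤ n + 1)
    (c : ℝ)
    (hfpt : Tendsto (fun e : ℕ => (nuFn I (p ^ e) : ℝ) / (p : ℝ) ^ e) atTop (nhds c))
    (hcl : intCl I = (((varIdeal k h : Ideal (MvPolynomial (Fin (n + 1)) k)) ^ d :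
            Ideal (MvPolynomial (Fin (n + 1)) k)) : Set (MvPolynomial (Fin (n + 1)) k))) :
    c = (h : ℝ) / d := by
  rw [varIdeal_pow] at hcl
  have hI : I ≤ ordIdl n k h d := by
    intro x hx
    have := subset_intCl I hx
    rwa [hcl] at this
  have hd' : (0 : ℝ) < d := by exact_mod_cast hd
  have hp' : (0 : ℝ) < p := by exact_mod_cast hp.pos
  apply le_antisymm
  · refine le_of_tendsto' hfpt fun e => ?_
    have := nuFn_le (q := p ^ e) hI hd
    rw [div_le_div_iff₀ (by positivity) hd']
    have h2 : (d * nuFn I (p ^ e) : ℝ) ≤ h * p ^ e := by exact_mod_cast this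
    linarith
  · have hS : ∀ f ∈ S, wHom h f d := fun f hf =>
      wHom_of_mem ((wHom_top_iff _ _).2 (hhom f hf)) (hI (hgen ▸ Ideal.subset_span hf))
    have hrad : (varIdeal k h : Ideal (MvPolynomial (Fin (n + 1)) k)) ≤ I.radical := by
      unfold varIdeal
      rw [Ideal.span_le]
      rintro _ ⟨i, hi, rfl⟩
      have h1 : (X i : MvPolynomial (Fin (n + 1)) k) ^ d ∈ intCl I := by
        rw [hcl]
        have := ordIdl_pow_mem (m := d) (X_mem_ordIdl (k := k) i hi)
        rwa [one_mul] at this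
      obtain ⟨m, _, hm⟩ := intCl_pow_mem h1
      exact ⟨d * m, by rwa [pow_mul]⟩
    obtain ⟨N, hN⟩ := Ideal.exists_pow_le_of_le_radical_of_fg hrad (IsNoetherian.noetherian _)
    rw [varIdeal_pow] at hN
    have hpow : ∀ r, ordIdl n k h (N + d * r) ≤ I ^ r := by
      intro r
      have := lemmaA_pow (N := N) hS cStable_bot (by rw [← hgen]; simpa using hN) r
      rw [sup_bot_eq, ← hgen] at this
      exact this.trans Ideal.mul_le_left
    have key : ∀ e : ℕ, (h : ℝ) ≤ d * ((nuFn I (p ^ e) : ℝ) / (p : ℝ) ^ e) + (h + N + d) * ((p : ℝ)⁻¹) ^ e := by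
      intro e
      have hq : 0 < p ^ e := pow_pos hp.pos _
      obtain ⟨q, hq'⟩ : ∃ q, q + 1 = p ^ e := ⟨p ^ e - 1, by omega⟩
      have h3 : h * p ^ e ≤ d * nuFn I (p ^ e) + (h + N + d) := by
        by_cases hqN : N ≤ h * q
        · set r := (h * q - N) / d with hr
          have h1 : r * d ≤ h * q - N := Nat.div_mul_le_self _ _
          have h2 : h * q - N < d * (r + 1) := by
            have := Nat.lt_mul_div_succ (h * q - N) hd
            simpa [hr] using this
          have h4 := le_nuFn hI hd (not_le_frobPow (r := r) hp hn hq' (hpow r) (by rw [mul_comm d]; omega))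
          have h5 : d * r ≤ d * nuFn I (p ^ e) := Nat.mul_le_mul_left _ h4
          rw [← hq'] at *
          nlinarith [Nat.sub_add_cancel hqN]
        · rw [← hq'] at *
          nlinarith
      have h6 : (h * p ^ e : ℝ) ≤ d * nuFn I (p ^ e) + (h + N + d) := by exact_mod_cast h3
      have hq'' : (0 : ℝ) < (p : ℝ) ^ e := by positivity
      rw [inv_pow]
      rw [show (d : ℝ) * ((nuFn I (p ^ e) : ℝ) / (p : ℝ) ^ e) + (h + N + d) * ((p : ℝ) ^ e)⁻¹
        = (d * nuFn I (p ^ e) + (h + N + d)) / (p : ℝ) ^ e by field_simp]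
      rw [le_div_iff₀ hq'']
      exact h6
    have hlim : Tendsto (fun e : ℕ => (d : ℝ) * ((nuFn I (p ^ e) : ℝ) / (p : ℝ) ^ e) + (h + N + d) * ((p : ℝ)⁻¹) ^ e)
        atTop (nhds (d * c + (h + N + d) * 0)) := by
      refine (hfpt.const_mul _).add (Tendsto.const_mul _ ?_)
      refine tendsto_pow_atTop_nhds_zero_of_lt_one (by positivity) ?_
      exact inv_lt_one_of_one_lt₀ (by exact_mod_cast hp.one_lt)
    have := ge_of_tendsto' hlim key
    rw [div_le_iff₀ hd']
    linarith

/-- The finishing step. -/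
lemma finish {n d h N : ℕ} (I : Ideal (MvPolynomial (Fin (n + 1)) k))
    (S : Set (MvPolynomial (Fin (n + 1)) k)) (hgen : I = Ideal.span S)
    (hS : ∀ f ∈ S, wHom h f d) (hN : ordIdl n k h N ≤ I) (hN0 : ordIdl n k h N ≠ ⊥) (hd : 0 < d) :
    intCl I = (((varIdeal k h : Ideal (MvPolynomial (Fin (n + 1)) k)) ^ d :
            Ideal (MvPolynomial (Fin (n + 1)) k)) : Set (MvPolynomial (Fin (n + 1)) k)) := by
  rw [varIdeal_pow]
  apply Set.Subset.antisymm
  · apply intCl_subset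
    rw [hgen, Ideal.span_le]
    intro f hf u hu
    exact (hS f hf u hu).ge
  · intro f hf
    have h1 := lemmaA_pow (N := N) hS cStable_bot (by rw [← hgen]; simpa using hN) 1
    rw [sup_bot_eq, ← hgen, mul_one, pow_one] at h1
    set B := ordIdl n k h N with hB
    have h2 : ∀ x ∈ B, f * x ∈ I * B := fun x hx =>
      h1 (by rw [add_comm N d]; exact ordIdl_mul_mem hf hx)
    let φ : B →ₗ[MvPolynomial (Fin (n + 1)) k] B := LinearMap.lsmul _ _ f
    have hφ : LinearMap.range φ ≤ I • (⊤ : Submodule (MvPolynomial (Fin (n + 1)) k) B) := by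
      rintro _ ⟨x, rfl⟩
      have h3 := h2 x x.2
      have h4 : Submodule.map B.subtype (I • (⊤ : Submodule (MvPolynomial (Fin (n + 1)) k) B)) = I * B := by
        rw [Submodule.map_smul'', Submodule.map_top, Submodule.range_subtype]; rfl
      rw [← h4] at h3
      obtain ⟨y, hy, hyx⟩ := h3
      have : φ x = y := by
        apply Subtype.ext
        exact hyx.symm
      rw [this]; exact hy
    have : Module.Finite (MvPolynomial (Fin (n + 1)) k) B := inferInstance
    obtain ⟨P, hPm, hPdeg, hPc, hP⟩ := LinearMap.exists_monic_and_natDegree_eq_and_coeff_mem_pow_and_aeval_eq_zero _ φ I hφ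
    obtain ⟨x, hx, hx0⟩ := Submodule.exists_mem_ne_zero_of_ne_bot hN0
    have hev : P.eval f = 0 := by
      have h5 : φ = algebraMap _ (Module.End (MvPolynomial (Fin (n + 1)) k) B) f := by
        ext y; rfl
      rw [h5, Polynomial.aeval_algebraMap_apply] at hP
      have h6 := congrArg (fun g : Module.End (MvPolynomial (Fin (n + 1)) k) B => ((g ⟨x, hx⟩ : B) : MvPolynomial (Fin (n + 1)) k)) hP
      have h7 : P.eval f * x = 0 := by
        simpa [Module.algebraMap_end_apply] using h6
      exact (mul_eq_zero.1 h7).resolve_right hx0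
    have hdeg : 0 < P.natDegree := by
      rw [Nat.pos_iff_ne_zero]
      intro h0
      rw [hPm.natDegree_eq_zero.1 h0] at hev
      simp at hev
    refine ⟨P.natDegree, hdeg, fun i => P.coeff (P.natDegree - i), ?_, ?_⟩
    · intro i hi
      rw [Finset.mem_Icc] at hi
      have := hPc (P.natDegree - i)
      rwa [Nat.sub_sub_self hi.2] at this
    · rw [Polynomial.eval_eq_sum_range, Finset.sum_range_succ, hPm.coeff_natDegree, one_mul] at hev
      rw [← hev, add_comm (f ^ P.natDegree), add_left_inj]
      refine Finset.sum_bij' (fun i _ => P.natDegree - i) (fun i _ => P.natDegree - i) ?_ ?_ ?_ ?_ ?_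
      · intro i hi; simp at *; omega
      · intro i hi; simp at *; omega
      · intro i hi; simp at *; omega
      · intro i hi; simp at *; omega
      · intro i hi; rfl

/-- linear form -/
def lin {n : ℕ} : (Fin (n + 1) → k) →ₗ[k] MvPolynomial (Fin (n + 1)) k where
  toFun a := ∑ i, MvPolynomial.C (a i) * X i
  map_add' a b := by simp [add_mul, Finset.sum_add_distrib]
  map_smul' c a := by simp [Finset.smul_sum, mul_assoc, MvPolynomial.smul_eq_C_mul]

lemma lin_single {n : ℕ} (i : Fin (n + 1)) : lin (Pi.single i (1 : k)) = X i := by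
  simp only [lin, LinearMap.coe_mk, AddHom.coe_mk]
  rw [Finset.sum_eq_single i]
  · simp
  · intro j _ hj; simp [hj]
  · simp

lemma eval_lin {n : ℕ} (a v : Fin (n + 1) → k) : eval v (lin a) = ∑ i, a i * v i := by
  simp [lin]

lemma mem_maxIdl {n : ℕ} {F : MvPolynomial (Fin (n + 1)) k} :
    F ∈ maxIdl n k ↔ coeff 0 F = 0 := by
  rw [maxIdl_eq]
  have := varIdeal_pow (n := n) (k := k) (n + 1) 1
  rw [pow_one] at this
  rw [this]
  constructor
  · intro h
    by_contra h0
    have := h 0 h0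
    simp [xdeg] at this
  · intro h u hu
    by_contra h1
    have h2 : u = 0 := by
      have h3 : xdeg (n + 1) u = 0 := by omega
      rw [xdeg_eq, Finset.sum_eq_zero_iff] at h3
      ext i
      have := h3 i (Finset.mem_univ _)
      have hi := i.2
      simpa [hi] using this
    rw [h2] at hu
    exact hu h

lemma maxIdl_ne_top {n : ℕ} : maxIdl n k ≠ ⊤ := by
  rw [Ideal.ne_top_iff_one, mem_maxIdl]
  simp

lemma maxIdl_isPrime {n : ℕ} : (maxIdl n k).IsPrime := by
  refine ⟨maxIdl_ne_top, ?_⟩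
  intro x y hxy
  simp only [mem_maxIdl] at *
  have : constantCoeff (x * y) = 0 := hxy
  rw [map_mul, mul_eq_zero] at this
  exact this

lemma height_maxIdl {n : ℕ} :
    Order.height (⟨maxIdl n k, maxIdl_isPrime⟩ : PrimeSpectrum (MvPolynomial (Fin (n + 1)) k)) ≤ ((n + 1 : ℕ) : ℕ∞) := by
  rw [← PrimeSpectrum.height_eq_orderHeight]
  classical
  have := Ideal.height_le_card_of_mem_minimalPrimes_span_finset (p := maxIdl n k)
    (s := Finset.univ.image (X : Fin (n + 1) → MvPolynomial (Fin (n + 1)) k)) (by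
      have hp : (maxIdl n k).IsPrime := maxIdl_isPrime
      have : Ideal.span ((Finset.univ.image (X : Fin (n + 1) → MvPolynomial (Fin (n + 1)) k) : Finset _) : Set (MvPolynomial (Fin (n + 1)) k)) = maxIdl n k := by
        simp [maxIdl]
      rw [this, Ideal.minimalPrimes_eq_subsingleton_self]
      rfl)
  refine this.trans ?_
  have h2 := Finset.card_image_le (s := Finset.univ) (f := (X : Fin (n + 1) → MvPolynomial (Fin (n + 1)) k))
  rw [Finset.card_univ, Fintype.card_fin] at h2
  exact_mod_cast h2

lemma eval_smul_homog {n d : ℕ} {f : MvPolynomial (Fin (n + 1)) k} (hf : f.IsHomogeneous d)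
    (v : Fin (n + 1) → k) (c : k) : eval (fun i => v i * c) f = c ^ d * eval v f := by
  rw [eval_eq', eval_eq', Finset.mul_sum]
  refine Finset.sum_congr rfl fun u hu => ?_
  have h1 := (wHom_top_iff f d).2 hf u (mem_support_iff.1 hu)
  rw [xdeg_eq] at h1
  have h2 : ∑ i, u i = d := by
    rw [← h1]
    exact Finset.sum_congr rfl fun i _ => by simp [i.2]
  simp only [mul_pow]
  rw [Finset.prod_mul_distrib, Finset.prod_pow_eq_pow_sum, h2]
  ring

/-- The prime of a line. -/
def linePrime {n : ℕ} (v : Fin (n + 1) → k) : Ideal (MvPolynomial (Fin (n + 1)) k) :=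
  RingHom.ker (aeval (fun i => Polynomial.C (v i) * Polynomial.X) :
    MvPolynomial (Fin (n + 1)) k →ₐ[k] Polynomial k)

lemma linePrime_isPrime {n : ℕ} (v : Fin (n + 1) → k) : (linePrime v).IsPrime :=
  RingHom.ker_isPrime _

lemma eval_line {n : ℕ} (v : Fin (n + 1) → k) (c : k) (F : MvPolynomial (Fin (n + 1)) k) :
    Polynomial.eval c (aeval (fun i => Polynomial.C (v i) * Polynomial.X) F) =
      eval (fun i => v i * c) F := by
  have : ((Polynomial.aeval c).comp (aeval (fun i => Polynomial.C (v i) * Polynomial.X) :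
    MvPolynomial (Fin (n + 1)) k →ₐ[k] Polynomial k)) = aeval (fun i => v i * c) := by
    apply MvPolynomial.algHom_ext
    intro i; simp
  have h2 := DFunLike.congr_fun this F
  simpa [aeval_eq_eval, Polynomial.aeval_def, Polynomial.eval₂_eq_eval_map] using h2

lemma mem_linePrime {n d : ℕ} [Infinite k] {v : Fin (n + 1) → k} {f : MvPolynomial (Fin (n + 1)) k}
    (hf : f.IsHomogeneous d) (hv : eval v f = 0) : f ∈ linePrime v := by
  unfold linePrime
  rw [RingHom.mem_ker]
  apply Polynomial.funext
  intro c
  have := eval_line v c f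
  rw [eval_smul_homog hf, hv, mul_zero] at this
  simpa using this

lemma linePrime_lt {n : ℕ} {v : Fin (n + 1) → k} (hv : v ≠ 0) : linePrime v < maxIdl n k := by
  obtain ⟨i, hi⟩ := Function.ne_iff.1 hv
  apply lt_of_le_of_ne
  · intro F hF
    have h0 := eval_line v 0 F
    have hF' : aeval (fun i => Polynomial.C (v i) * Polynomial.X) F = 0 := hF
    rw [hF'] at h0
    rw [mem_maxIdl]
    have h1 : (fun i => v i * (0 : k)) = 0 := by funext i; simp
    rw [h1, Polynomial.eval_zero] at h0
    have h2 : eval 0 F = constantCoeff F := by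
      rw [MvPolynomial.eval_zero]
    rw [h2] at h0
    exact h0.symm
  · intro h
    have : X i ∈ linePrime v := by rw [h]; exact Ideal.subset_span ⟨i, rfl⟩
    have h2 : aeval (fun i => Polynomial.C (v i) * Polynomial.X) (X i : MvPolynomial (Fin (n + 1)) k) = 0 := this
    rw [aeval_X] at h2
    simp at h2
    exact hi h2

lemma height_le_of_prime {n h : ℕ} {I : Ideal (MvPolynomial (Fin (n + 1)) k)}
    (hh : idealHeight I = (h : ℕ∞)) (Q : PrimeSpectrum (MvPolynomial (Fin (n + 1)) k))
    (hQ : I ≤ Q.asIdeal) : (h : ℕ∞) ≤ Order.height Q := by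
  rw [← hh]
  exact iInf₂_le Q hQ

lemma h_le {n h : ℕ} {I : Ideal (MvPolynomial (Fin (n + 1)) k)}
    (hh : idealHeight I = (h : ℕ∞)) (hI : I ≤ maxIdl n k) : h ≤ n + 1 := by
  have h1 := height_le_of_prime hh ⟨maxIdl n k, maxIdl_isPrime⟩ hI
  exact_mod_cast h1.trans height_maxIdl

lemma generic_forms {n h : ℕ} [Infinite k] {I : Ideal (MvPolynomial (Fin (n + 1)) k)}
    (hh : idealHeight I = (h : ℕ∞)) (j : ℕ) :
    ∃ a : Fin j → (Fin (n + 1) → k), ∀ Q : PrimeSpectrum (MvPolynomial (Fin (n + 1)) k),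
      I ≤ Q.asIdeal → (∀ i, lin (a i) ∈ Q.asIdeal) → ¬ maxIdl n k ≤ Q.asIdeal →
      ((h + j : ℕ) : ℕ∞) ≤ Order.height Q := by
  classical
  induction j with
  | zero => exact ⟨Fin.elim0, fun Q hQ _ _ => by simpa using height_le_of_prime hh Q hQ⟩
  | succ j ih =>
    obtain ⟨a, ha⟩ := ih
    set K := I ⊔ Ideal.span (Set.range fun i => lin (a i)) with hK
    have hfin := Ideal.finite_minimalPrimes_of_isNoetherianRing (MvPolynomial (Fin (n + 1)) k) K
    let W : Ideal (MvPolynomial (Fin (n + 1)) k) → Subspace k (Fin (n + 1) → k) :=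
      fun P => Submodule.comap lin (P.restrictScalars k)
    let s : Finset (Subspace k (Fin (n + 1) → k)) :=
      (hfin.toFinset.filter (fun P => ¬ maxIdl n k ≤ P)).image W
    have hs : ⊤ ∉ s := by
      intro h
      obtain ⟨P, hP, hW⟩ := Finset.mem_image.1 h
      rw [Finset.mem_filter] at hP
      apply hP.2
      unfold maxIdl
      rw [Ideal.span_le]
      rintro _ ⟨i, rfl⟩
      have h1 : Pi.single i (1 : k) ∈ W P := by rw [hW]; trivial
      have h2 : lin (Pi.single i (1 : k)) ∈ P := h1
      rwa [lin_single] at h2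
    have hne := Subspace.biUnion_ne_univ_of_top_notMem hs
    obtain ⟨b, hb⟩ := (Set.ne_univ_iff_exists_notMem _).1 hne
    refine ⟨Fin.cons b a, fun Q hQ hQa hQm => ?_⟩
    rw [Fin.forall_fin_succ] at hQa
    simp only [Fin.cons_zero, Fin.cons_succ] at hQa
    have hKQ : K ≤ Q.asIdeal := by
      refine sup_le hQ ?_
      rw [Ideal.span_le]
      rintro _ ⟨i, rfl⟩
      exact hQa.2 i
    have := Q.isPrime
    obtain ⟨P, hP, hPQ⟩ := Ideal.exists_minimalPrimes_le hKQ
    have hPm : ¬ maxIdl n k ≤ P := fun h => hQm (h.trans hPQ)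
    have hbP : lin b ∉ P := by
      intro h
      apply hb
      simp only [Set.mem_iUnion]
      exact ⟨W P, Finset.mem_image.2 ⟨P, Finset.mem_filter.2 ⟨hfin.mem_toFinset.2 hP, hPm⟩, rfl⟩, h⟩
    have hlt : (⟨P, hP.1.1⟩ : PrimeSpectrum (MvPolynomial (Fin (n + 1)) k)) < Q := by
      apply lt_of_le_of_ne
      · exact hPQ
      · intro h
        rw [← h] at hQa
        exact hbP hQa.1
    have hKP : K ≤ P := hP.1.2
    have h1 := ha ⟨P, hP.1.1⟩ (le_sup_left.trans hKP)
      (fun i => hKP (Ideal.mem_sup_right (Ideal.subset_span ⟨i, rfl⟩))) hPm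
    have h2 := Order.height_add_one_le hlt
    refine le_trans ?_ h2
    rw [← add_assoc, Nat.cast_add _ 1, Nat.cast_one]
    exact add_le_add h1 le_rfl

lemma exists_forms {n h d : ℕ} [Infinite k] {I : Ideal (MvPolynomial (Fin (n + 1)) k)}
    {S : Set (MvPolynomial (Fin (n + 1)) k)} (hgen : I = Ideal.span S)
    (hhom : ∀ f ∈ S, f.IsHomogeneous d)
    (hh : idealHeight I = (h : ℕ∞)) (hn : h ≤ n + 1) :
    ∃ a : Fin (n + 1 - h) → (Fin (n + 1) → k), ∀ v : Fin (n + 1) → k,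
      (∀ f ∈ I, eval v f = 0) → (∀ i, eval v (lin (a i)) = 0) → v = 0 := by
  obtain ⟨a, ha⟩ := generic_forms hh (n + 1 - h)
  refine ⟨a, fun v hv hva => ?_⟩
  by_contra hv0
  have hlt := linePrime_lt hv0
  have h1 := ha ⟨linePrime v, linePrime_isPrime v⟩ (by
    change I ≤ linePrime v
    rw [hgen, Ideal.span_le]
    intro f hf
    exact mem_linePrime (hhom f hf) (hv f (hgen ▸ Ideal.subset_span hf))) (by
    intro i
    refine mem_linePrime (d := 1) ?_ (hva i)
    refine IsHomogeneous.sum _ _ _ fun j _ => ?_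
    exact (isHomogeneous_X k j).C_mul _) (not_le_of_gt hlt)
  have h2 : (⟨linePrime v, linePrime_isPrime v⟩ : PrimeSpectrum (MvPolynomial (Fin (n + 1)) k))
    < ⟨maxIdl n k, maxIdl_isPrime⟩ := hlt
  have h3 := (Order.height_add_one_le h2).trans height_maxIdl
  have h4 : h + (n + 1 - h) = n + 1 := by omega
  rw [h4] at h1
  have h5 := (add_le_add h1 (le_refl (1 : ℕ∞))).trans h3
  have : n + 1 + 1 ≤ n + 1 := by exact_mod_cast h5
  omega

lemma extend_matrix {N s : ℕ} (v : Fin s → (Fin N → k)) (hv : LinearIndependent k v) :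
    ∃ hs : s ≤ N, ∃ M : Matrix (Fin N) (Fin N) k, IsUnit M.det ∧
      ∀ i : Fin s, ∀ l, M l (Fin.castLE hs i) = v i l := by
  classical
  have hs : s ≤ N := by
    have := hv.fintype_card_le_finrank
    simpa using this
  refine ⟨hs, ?_⟩
  let b := Module.Basis.sumExtend hv
  let E := Module.Basis.sumExtendIndex hv
  have : Fintype (Fin s ⊕ E) := FiniteDimensional.fintypeBasisIndex b
  have : Fintype E := Fintype.ofInjective (Sum.inr : E → Fin s ⊕ E) Sum.inr_injective
  have hc : Fintype.card E = N - s := by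
    have h1 := Module.finrank_eq_card_basis b
    simp only [Module.finrank_fintype_fun_eq_card, Fintype.card_fin] at h1
    have h2 : Fintype.card (Fin s ⊕ E) = s + Fintype.card E := by
      rw [Fintype.card_eq_nat_card, Nat.card_sum]; simp
    rw [h2] at h1
    omega
  let e1 : E ≃ Fin (N - s) := Fintype.equivFinOfCardEq hc
  let e : Fin s ⊕ E ≃ Fin N :=
    ((Equiv.sumCongr (Equiv.refl _) e1).trans finSumFinEquiv).trans (finCongr (by omega))
  let b' : Module.Basis (Fin N) k (Fin N → k) := b.reindex e
  refine ⟨Matrix.of fun l j => b' j l, ?_, ?_⟩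
  · rw [← Matrix.isUnit_iff_isUnit_det, ← Matrix.linearIndependent_cols_iff_isUnit]
    exact b'.linearIndependent
  · intro i l
    have h1 : e (Sum.inl i) = Fin.castLE hs i := by
      ext; simp [e]
    have h2 : b' (Fin.castLE hs i) = v i := by
      rw [← h1]
      simp only [b', Module.Basis.reindex_apply, Equiv.symm_apply_apply]
      simp [b, Module.Basis.sumExtend]
      rfl
    simp [h2]

/-- Coordinates adapted to a generic complete intersection. -/
lemma coordsA {n h d : ℕ} [IsAlgClosed k] {I : Ideal (MvPolynomial (Fin (n + 1)) k)}
    {S : Set (MvPolynomial (Fin (n + 1)) k)} (hgen : I = Ideal.span S)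
    (hhom : ∀ f ∈ S, f.IsHomogeneous d)
    (hh : idealHeight I = (h : ℕ∞)) (hn : h ≤ n + 1) :
    ∃ M : Matrix (Fin (n + 1)) (Fin (n + 1)) k, IsUnit M.det ∧ ∃ N,
      ordIdl n k (n + 1) N ≤ I.map (coordChange M) ⊔ zIdeal n k h := by
  have : Infinite k := IsAlgClosed.instInfinite
  obtain ⟨a, ha⟩ := exists_forms hgen hhom hh hn
  let L : (Fin (n + 1) → k) →ₗ[k] (Fin (n + 1 - h) → k) := Matrix.toLin' (Matrix.of a)
  have hL : ∀ v i, L v i = eval v (lin (a i)) := by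
    intro v i
    rw [eval_lin]; simp [L, Matrix.mulVec, dotProduct]
  have hr : h ≤ Module.finrank k (LinearMap.ker L) := by
    have h1 := LinearMap.finrank_range_add_finrank_ker L
    have h2 := Submodule.finrank_le (LinearMap.range L)
    simp only [Module.finrank_fintype_fun_eq_card, Fintype.card_fin] at h1 h2
    omega
  let b := Module.finBasis k (LinearMap.ker L)
  let v : Fin h → (Fin (n + 1) → k) := fun i => (b (Fin.castLE hr i) : Fin (n + 1) → k)
  have hv : LinearIndependent k v := by
    have h1 : LinearIndependent k (fun i : Fin h => b (Fin.castLE hr i)) :=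
      b.linearIndependent.comp _ (Fin.castLE_injective hr)
    exact h1.map' (LinearMap.ker L).subtype (Submodule.ker_subtype _)
  obtain ⟨hs, M, hM, hMv⟩ := extend_matrix v hv
  refine ⟨M, hM, ?_⟩
  have hrad : maxIdl n k ≤ (I.map (coordChange M) ⊔ zIdeal n k h).radical := by
    rw [← vanishingIdeal_zeroLocus_eq_radical (K := k)]
    unfold maxIdl
    rw [Ideal.span_le]
    rintro _ ⟨i, rfl⟩
    simp only [SetLike.mem_coe, mem_vanishingIdeal_iff]
    intro w hw
    rw [mem_zeroLocus_iff] at hw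
    simp only [aeval_eq_eval, coe_eval₂Hom] at hw
    have hwz : ∀ j : Fin (n + 1), h ≤ (j : ℕ) → w j = 0 := by
      intro j hj
      have := hw (X j) (Ideal.mem_sup_right (Ideal.subset_span ⟨j, hj, rfl⟩))
      simpa using this
    have hMw : M.mulVec w = 0 := by
      apply ha
      · intro f hf
        rw [← aeval_coordChange]
        have := hw (coordChange M f) (Ideal.mem_sup_left (Ideal.mem_map_of_mem _ hf))
        simpa using this
      · intro i
        rw [← hL]
        have h1 : M.mulVec w = ∑ j : Fin (n + 1), w j • M.col j := by
          ext l
          simp [Matrix.mulVec, dotProduct, mul_comm]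
        have h2 : M.mulVec w ∈ LinearMap.ker L := by
          rw [h1]
          refine Submodule.sum_mem _ fun j _ => ?_
          by_cases hj : (j : ℕ) < h
          · refine Submodule.smul_mem _ _ ?_
            have h3 : M.col j = v ⟨j, hj⟩ := by
              ext l
              rw [← hMv]; rfl
            rw [h3]
            exact (b _).2
          · rw [hwz j (by omega), zero_smul]; exact zero_mem _
        rw [LinearMap.mem_ker] at h2
        rw [h2]; rfl
    have : w = 0 := by
      have h1 : M⁻¹.mulVec (M.mulVec w) = 0 := by rw [hMw, Matrix.mulVec_zero]
      rwa [Matrix.mulVec_mulVec, Matrix.nonsing_inv_mul _ hM, Matrix.one_mulVec] at h1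
    simp [this]
  obtain ⟨N, hN⟩ := Ideal.exists_pow_le_of_le_radical_of_fg hrad (IsNoetherian.noetherian _)
  rw [maxIdl_eq, varIdeal_pow] at hN
  exact ⟨N, hN⟩

lemma varIdeal_isPrime {n : ℕ} (s : ℕ) : (varIdeal k s : Ideal (MvPolynomial (Fin (n + 1)) k)).IsPrime := by
  have h0 := varIdeal_pow (n := n) (k := k) s 1
  rw [pow_one] at h0
  rw [h0]
  refine ⟨?_, ?_⟩
  · rw [Ideal.ne_top_iff_one]
    intro h
    have := h 0 (by simp)
    simp [xdeg] at this
  · intro F G hFG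
    by_contra! H
    obtain ⟨s1, hs1, h1, h2, h3⟩ := exists_lowest H.1
    obtain ⟨s2, hs2, h1', h2', h3'⟩ := exists_lowest H.2
    obtain rfl : s1 = 0 := by omega
    obtain rfl : s2 = 0 := by omega
    have h4 : comp s 0 F * comp s 0 G ∈ ordIdl n k s (0 + 0 + 1) := by
      have : comp s 0 F * comp s 0 G = F * G - (F - comp s 0 F) * G - comp s 0 F * (G - comp s 0 G) := by ring
      rw [this]
      refine sub_mem (sub_mem hFG (Ideal.mul_mem_right _ _ h3)) (Ideal.mul_mem_left _ _ h3')
    have h5 := ordIdl_ne_of_wHom (wHom_mul (wHom_comp s 0 F) (wHom_comp s 0 G)) h4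
    rcases mul_eq_zero.1 h5 with h | h
    · exact h2 h
    · exact h2' h

lemma X_not_mem_varIdeal {n s : ℕ} (i : Fin (n + 1)) (hi : s ≤ (i : ℕ)) :
    (X i : MvPolynomial (Fin (n + 1)) k) ∉ varIdeal k s := by
  have h0 := varIdeal_pow (n := n) (k := k) s 1
  rw [pow_one] at h0
  rw [h0]
  intro h
  have := h (Finsupp.single i 1) (by simp)
  have hni : ¬ (i : ℕ) < s := by omega
  simp [xdeg, Finsupp.weight_single, wt, hni] at this

lemma varIdeal_mono {n s t : ℕ} (hst : s ≤ t) :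
    (varIdeal k s : Ideal (MvPolynomial (Fin (n + 1)) k)) ≤ varIdeal k t := by
  unfold varIdeal
  refine Ideal.span_mono ?_
  rintro _ ⟨i, hi, rfl⟩
  exact ⟨i, by omega, rfl⟩

/-- A chain of linear primes in changed coordinates. -/
def chainPrime {n : ℕ} (M : Matrix (Fin (n + 1)) (Fin (n + 1)) k) (s : ℕ) :
    PrimeSpectrum (MvPolynomial (Fin (n + 1)) k) :=
  ⟨(varIdeal k s : Ideal (MvPolynomial (Fin (n + 1)) k)).comap (coordChange M),
    haveI := varIdeal_isPrime (n := n) (k := k) s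
    Ideal.comap_isPrime (coordChange M) (varIdeal k s)⟩

lemma mem_chainPrime {n : ℕ} (M : Matrix (Fin (n + 1)) (Fin (n + 1)) k) (s : ℕ)
    (F : MvPolynomial (Fin (n + 1)) k) :
    F ∈ (chainPrime M s).asIdeal ↔ coordChange M F ∈ varIdeal k s := Iff.rfl

lemma chainPrime_lt {n s : ℕ} (M : Matrix (Fin (n + 1)) (Fin (n + 1)) k)
    (hM : IsUnit M.det) (hs : s < n + 1) : chainPrime M s < chainPrime M (s + 1) := by
  apply lt_of_le_of_ne
  · rw [← PrimeSpectrum.asIdeal_le_asIdeal]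
    intro F hF
    rw [mem_chainPrime] at hF ⊢
    exact varIdeal_mono (Nat.le_succ s) hF
  · intro h
    obtain ⟨i, hi⟩ : ∃ i : Fin (n + 1), (i : ℕ) = s := ⟨⟨s, hs⟩, rfl⟩
    have h3 : coordChange M (coordChange M⁻¹ (X i)) = X i := by
      rw [coordChange_comp, Matrix.nonsing_inv_mul _ hM, coordChange_one]
    have h1 : coordChange M⁻¹ (X i) ∈ (chainPrime M (s + 1)).asIdeal := by
      rw [mem_chainPrime, h3]
      exact Ideal.subset_span ⟨i, by rw [hi]; exact Nat.lt_succ_self s, rfl⟩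
    rw [← h, mem_chainPrime, h3] at h1
    exact X_not_mem_varIdeal i hi.ge h1

lemma height_ge {n t : ℕ} (ht : t ≤ n + 1) (M : Matrix (Fin (n + 1)) (Fin (n + 1)) k)
    (hM : IsUnit M.det) (Q : PrimeSpectrum (MvPolynomial (Fin (n + 1)) k))
    (hQ : (varIdeal k t : Ideal (MvPolynomial (Fin (n + 1)) k)).comap (coordChange M) ≤ Q.asIdeal) :
    (t : ℕ∞) ≤ Order.height Q := by
  have key : ∀ s : ℕ, s ≤ t → (s : ℕ∞) ≤ Order.height (chainPrime M s) := by
    intro s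
    induction s with
    | zero => intro _; simp
    | succ s ih =>
      intro hs
      refine le_trans ?_ (Order.height_add_one_le (chainPrime_lt M hM (by omega)))
      rw [Nat.cast_add, Nat.cast_one]
      exact add_le_add (ih (by omega)) le_rfl
  refine (key t le_rfl).trans (Order.height_mono ?_)
  rw [← PrimeSpectrum.asIdeal_le_asIdeal]
  exact hQ

/-- Coordinates adapted to the linear span of the zero locus. -/
lemma coordsB {n h d : ℕ} [IsAlgClosed k] {I : Ideal (MvPolynomial (Fin (n + 1)) k)}
    (hh : idealHeight I = (h : ℕ∞)) :
    ∃ M : Matrix (Fin (n + 1)) (Fin (n + 1)) k, IsUnit M.det ∧ ∃ t, t ≤ h ∧ t ≤ n + 1 ∧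
      (varIdeal k t ≤ (I.map (coordChange M)).radical) ∧
      ∀ f ∈ I, ∀ j : Fin (n + 1), t ≤ (j : ℕ) → f.IsHomogeneous d →
        coeff (Finsupp.single j d) (coordChange M f) = 0 := by
  classical
  let V : Set (Fin (n + 1) → k) := zeroLocus k I
  obtain ⟨B, hBV, hBspan, hBli⟩ := exists_linearIndependent k V
  have hBfin : Finite B := hBli.finite
  have : Fintype B := Fintype.ofFinite B
  let s := Fintype.card B
  let e : B ≃ Fin s := Fintype.equivFin B
  let v : Fin s → (Fin (n + 1) → k) := fun i => (e.symm i : Fin (n + 1) → k)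
  have hv : LinearIndependent k v := hBli.comp e.symm e.symm.injective
  have hvV : ∀ i, v i ∈ V := fun i => hBV (e.symm i).2
  have hVv : ∀ x ∈ V, x ∈ Submodule.span k (Set.range v) := by
    intro x hx
    have h1 : x ∈ Submodule.span k V := Submodule.subset_span hx
    rw [← hBspan] at h1
    have : Set.range v = B := by
      ext y; constructor
      · rintro ⟨i, rfl⟩; exact (e.symm i).2
      · intro hy; exact ⟨e ⟨y, hy⟩, by simp [v]⟩
    rwa [this]
  obtain ⟨hs, M0, hM0, hM0v⟩ := extend_matrix v hv
  let M : Matrix (Fin (n + 1)) (Fin (n + 1)) k := M0.submatrix id Fin.rev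
  have hM : IsUnit M.det := by
    have : M.det = _ := Matrix.det_permute' Fin.revPerm M0
    rw [this]
    refine IsUnit.mul ?_ hM0
    exact (Units.isUnit _).map (Int.castRingHom k)
  have hcol : ∀ j : Fin (n + 1), n + 1 - s ≤ (j : ℕ) → ∃ i : Fin s, M.col j = v i ∧ True := by
    intro j hj
    have hjr : (Fin.rev j : ℕ) < s := by
      rw [Fin.val_rev]; have := j.2; omega
    refine ⟨⟨Fin.rev j, hjr⟩, ?_, trivial⟩
    ext l
    rw [← hM0v]; rfl
  have hcol' : ∀ i : Fin s, ∃ j : Fin (n + 1), n + 1 - s ≤ (j : ℕ) ∧ v i = M.col j := by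
    intro i
    refine ⟨Fin.rev (Fin.castLE hs i), ?_, ?_⟩
    · rw [Fin.val_rev]; simp; have := i.2; omega
    · ext l
      simp only [M, Matrix.col_apply, Matrix.submatrix_apply, Fin.rev_rev, id]
      rw [hM0v]
  have hrad : (varIdeal k (n + 1 - s) : Ideal (MvPolynomial (Fin (n + 1)) k)) ≤ (I.map (coordChange M)).radical := by
    rw [← vanishingIdeal_zeroLocus_eq_radical (K := k)]
    unfold varIdeal
    rw [Ideal.span_le]
    rintro _ ⟨i, hi, rfl⟩
    simp only [SetLike.mem_coe, mem_vanishingIdeal_iff]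
    intro w hw
    rw [mem_zeroLocus_iff] at hw
    have hMw : M.mulVec w ∈ V := by
      rw [mem_zeroLocus_iff]
      intro f hf
      have h1 := hw (coordChange M f) (Ideal.mem_map_of_mem _ hf)
      have h2 := aeval_coordChange M f w
      simp only [aeval_eq_eval, coe_eval₂Hom] at h1 ⊢
      simpa using h2.symm.trans (by simpa using h1)
    have h3 := hVv _ hMw
    have h4 : ∀ x ∈ Submodule.span k (Set.range v), (M⁻¹.mulVec x) i = 0 := by
      intro x hx
      induction hx using Submodule.span_induction with
      | zero => simp
      | add x y _ _ hx hy => rw [Matrix.mulVec_add, Pi.add_apply, hx, hy, add_zero]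
      | smul c x _ hx => rw [Matrix.mulVec_smul, Pi.smul_apply, hx, smul_zero]
      | mem x hx =>
        obtain ⟨l, rfl⟩ := hx
        obtain ⟨j, hj, hvj⟩ := hcol' l
        have h5 : M.mulVec (Pi.single j 1) = M.col j := Matrix.mulVec_single_one M j
        rw [hvj, ← h5, Matrix.mulVec_mulVec, Matrix.nonsing_inv_mul _ hM, Matrix.one_mulVec]
        have : i ≠ j := by intro h; rw [h] at hi; omega
        simp [this]
    have h5 := h4 _ h3
    rw [Matrix.mulVec_mulVec, Matrix.nonsing_inv_mul _ hM, Matrix.one_mulVec] at h5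
    simpa using h5
  refine ⟨M, hM, n + 1 - s, ?_, by omega, hrad, ?_⟩
  · have h1 : ((n + 1 - s : ℕ) : ℕ∞) ≤ idealHeight I := by
      unfold idealHeight
      refine le_iInf₂ fun Q hQ => ?_
      refine height_ge (by omega) M hM Q ?_
      intro F hF
      rw [Ideal.mem_comap] at hF
      obtain ⟨m, hm⟩ := hrad hF
      rw [← map_pow, mem_map_coord M hM] at hm
      exact Q.isPrime.mem_of_pow_mem _ (hQ hm)
    rw [hh] at h1
    exact_mod_cast h1
  · intro f hf j hj hfd
    obtain ⟨i, hi, _⟩ := hcol j hj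
    have h1 : eval (Pi.single j 1) (coordChange M f) = 0 := by
      rw [aeval_coordChange, Matrix.mulVec_single_one, hi]
      have := (mem_zeroLocus_iff.1 (hvV i)) f hf
      simpa [aeval_eq_eval] using this
    rw [eval_eq'] at h1
    have hg := (wHom_top_iff _ _).2 (coordChange_homog M hfd)
    rw [Finset.sum_eq_single (Finsupp.single j d)] at h1
    · rw [Finset.prod_eq_single j] at h1
      · simpa using h1
      · intro l _ hl; simp [hl]
      · simp
    · intro u hu hne
      by_contra h0
      apply hne
      have hu0 : ∀ l, l ≠ j → u l = 0 := by
        intro l hl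
        by_contra hul
        apply h0
        rw [Finset.prod_eq_zero (Finset.mem_univ l), mul_zero]
        simp [hl, hul]
      have h2 := hg u (mem_support_iff.1 hu)
      rw [xdeg_eq, Finset.sum_eq_single j] at h2
      · simp only [j.2, if_true] at h2
        ext l
        by_cases hl : l = j
        · subst hl; simp [h2]
        · simp [hu0 l hl, Finsupp.single_apply, Ne.symm hl]
      · intro l _ hl; simp [hu0 l hl]
      · simp
    · intro h0
      rw [notMem_support_iff.1 h0, zero_mul]

/-- forms of degree `D` in `I ^ r` -/
def Wsp {n : ℕ} (I : Ideal (MvPolynomial (Fin (n + 1)) k)) (r D : ℕ) :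
    Submodule k (MvPolynomial (Fin (n + 1)) k) :=
  (I ^ r).restrictScalars k ⊓ homogeneousSubmodule (Fin (n + 1)) k D

lemma mem_Wsp {n : ℕ} {I : Ideal (MvPolynomial (Fin (n + 1)) k)} {r D : ℕ} {F} :
    F ∈ Wsp I r D ↔ F ∈ I ^ r ∧ F.IsHomogeneous D := by
  unfold Wsp
  rw [Submodule.mem_inf, Submodule.restrictScalars_mem, mem_homogeneousSubmodule]

lemma Wsp_finite {n : ℕ} (I : Ideal (MvPolynomial (Fin (n + 1)) k)) (r D : ℕ) :
    FiniteDimensional k (Wsp I r D) := by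
  have : FiniteDimensional k (homogeneousSubmodule (Fin (n + 1)) k D) :=
    Module.Finite.iff_fg.2 (homogeneousSubmodule_fg _ _ D)
  exact Submodule.finiteDimensional_of_le (inf_le_right : Wsp I r D ≤ _)

lemma Wsp_finrank_map {n : ℕ} (M : Matrix (Fin (n + 1)) (Fin (n + 1)) k) (hM : IsUnit M.det)
    (I : Ideal (MvPolynomial (Fin (n + 1)) k)) (r D : ℕ) :
    Module.finrank k (Wsp (I.map (coordChange M)) r D) = Module.finrank k (Wsp I r D) := by
  have h1 : Wsp (I.map (coordChange M)) r D =
      (Wsp I r D).map ((coordEquiv M hM).toLinearEquiv : _ →ₗ[k] _) := by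
    ext F
    rw [Submodule.mem_map, mem_Wsp, ← Ideal.map_pow]
    constructor
    · rintro ⟨h1, h2⟩
      have h3 : coordChange M (coordChange M⁻¹ F) = F := by
        rw [coordChange_comp, Matrix.nonsing_inv_mul _ hM, coordChange_one]
      refine ⟨coordChange M⁻¹ F, ?_, h3⟩
      rw [mem_Wsp]
      refine ⟨?_, coordChange_homog _ h2⟩
      rw [← mem_map_coord M hM, h3]; exact h1
    · rintro ⟨G, hG, rfl⟩
      rw [mem_Wsp] at hG
      exact ⟨(mem_map_coord M hM _ _).2 hG.1, coordChange_homog _ hG.2⟩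
  rw [h1]
  exact LinearEquiv.finrank_map_eq _ _

/-- monomials of degree `D` -/
def Mon (n D : ℕ) : Finset (Fin (n + 1) →₀ ℕ) := Finset.finsuppAntidiag Finset.univ D

lemma mem_Mon {n D : ℕ} {u : Fin (n + 1) →₀ ℕ} : u ∈ Mon n D ↔ ∑ i, u i = D := by
  simp [Mon]

lemma xdeg_top {n : ℕ} (u : Fin (n + 1) →₀ ℕ) : xdeg (n + 1) u = ∑ i, u i := by
  rw [xdeg_eq]
  refine Finset.sum_congr rfl fun i _ => ?_
  simp [i.2]

lemma homog_monomial {n : ℕ} (u : Fin (n + 1) →₀ ℕ) (a : k) :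
    wHom (n + 1) (monomial u a) (∑ i, u i) := by
  intro v hv
  rw [coeff_monomial] at hv
  have : u = v := by by_contra H; simp [H] at hv
  rw [← this, xdeg_top]

lemma reduce_step {n h d N r : ℕ} {S : Set (MvPolynomial (Fin (n + 1)) k)}
    (hhom : ∀ f ∈ S, f.IsHomogeneous d)
    (hN : ordIdl n k (n + 1) N ≤ Ideal.span S ⊔ zIdeal n k h)
    (u : Fin (n + 1) →₀ ℕ) (hu : d * r + N ≤ xdeg h u) :
    ∃ G ∈ Wsp (Ideal.span S) r (∑ i, u i), ∀ v, coeff v (monomial u 1 - G) ≠ 0 →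
      xdeg h v < xdeg h u := by
  classical
  have hS : ∀ f ∈ S, wHom (n + 1) f d := fun f hf => (wHom_top_iff _ _).2 (hhom f hf)
  let a : Fin (n + 1) →₀ ℕ := u.filter fun i => (i : ℕ) < h
  let b : Fin (n + 1) →₀ ℕ := u.filter fun i => ¬ (i : ℕ) < h
  have hab : a + b = u := Finsupp.filter_add_filter_not _ _
  have ha : ∑ i, a i = xdeg h u := by
    rw [xdeg_eq]
    refine Finset.sum_congr rfl fun i _ => ?_
    simp [a, Finsupp.filter_apply]
  have hb : xdeg h b = 0 := by
    rw [xdeg_eq]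
    refine Finset.sum_eq_zero fun i _ => ?_
    simp only [b, Finsupp.filter_apply]
    split_ifs <;> rfl
  have hsum : ∑ i, a i + ∑ i, b i = ∑ i, u i := by
    rw [← Finset.sum_add_distrib]
    refine Finset.sum_congr rfl fun i _ => ?_
    rw [← hab]; rfl
  have h1 : (monomial a 1 : MvPolynomial (Fin (n + 1)) k) ∈ ordIdl n k (n + 1) (N + d * r) := by
    intro v hv
    rw [homog_monomial a 1 v hv, ha]; omega
  have h2 := lemmaA_pow hS cStable_zIdeal hN r h1
  have h3 := sup_le_sup_right (Ideal.mul_le_left : (Ideal.span S) ^ r * ordIdl n k (n + 1) N ≤ _)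
    (zIdeal n k h) h2
  obtain ⟨G0, hG0, z0, hz0, hGz⟩ := Submodule.mem_sup.1 h3
  have h4 : comp (n + 1) (xdeg h u) G0 + comp (n + 1) (xdeg h u) z0 = monomial a 1 := by
    rw [← map_add, hGz, comp_of_wHom (homog_monomial a 1), ha, if_pos rfl]
  have hG1 := cStable_pow (cStable_span hS) r G0 hG0 (xdeg h u)
  have hz1 := cStable_zIdeal (h' := n + 1) z0 hz0 (xdeg h u)
  have hG2 := wHom_comp (n + 1) (xdeg h u) G0
  have hz2 := wHom_comp (n + 1) (xdeg h u) z0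
  set G := comp (n + 1) (xdeg h u) G0
  set z := comp (n + 1) (xdeg h u) z0
  refine ⟨G * monomial b 1, ?_, ?_⟩
  · rw [mem_Wsp]
    refine ⟨Ideal.mul_mem_right _ _ hG1, ?_⟩
    rw [← wHom_top_iff, ← hsum, ha]
    exact wHom_mul hG2 (homog_monomial b 1)
  · intro v hv
    have h5 : (monomial u 1 : MvPolynomial (Fin (n + 1)) k) - G * monomial b 1 = z * monomial b 1 := by
      have : (monomial u 1 : MvPolynomial (Fin (n + 1)) k) = monomial a 1 * monomial b 1 := by
        rw [monomial_mul, hab, mul_one]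
      rw [this, ← h4]; ring
    rw [h5, coeff_mul_monomial'] at hv
    split_ifs at hv with hbv
    · rw [mul_one] at hv
      have h6 := hz2 _ hv
      obtain ⟨i, hi, hvi⟩ := mem_zIdeal.1 hz1 _ hv
      have h7 : v = (v - b) + b := (tsub_add_cancel_of_le hbv).symm
      rw [h7, xdeg_add, hb, add_zero]
      rw [xdeg_top] at h6
      rw [← h6, xdeg_eq]
      refine Finset.sum_lt_sum (fun j _ => ?_) ⟨i, Finset.mem_univ _, ?_⟩
      · split_ifs <;> simp
      · rw [if_neg (by omega)]; omega
    · exact absurd rfl hv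

lemma count_le {n h d N r D : ℕ} {S : Set (MvPolynomial (Fin (n + 1)) k)}
    (hhom : ∀ f ∈ S, f.IsHomogeneous d)
    (hN : ordIdl n k (n + 1) N ≤ Ideal.span S ⊔ zIdeal n k h) :
    ((Mon n D).filter fun u => d * r + N ≤ xdeg h u).card ≤
      Module.finrank k (Wsp (Ideal.span S) r D) := by
  classical
  set T := (Mon n D).filter fun u => d * r + N ≤ xdeg h u with hT
  let π : MvPolynomial (Fin (n + 1)) k →ₗ[k] (T → k) := LinearMap.pi fun u => lcoeff k u.1
  have hπ : ∀ F u, π F u = coeff u.1 F := fun F u => rfl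
  have := Wsp_finite (Ideal.span S) r D
  have key : ∀ m, ∀ u : T, xdeg h u.1 = m → (Pi.single u 1 : T → k) ∈ (Wsp (Ideal.span S) r D).map π := by
    intro m
    induction m using Nat.strong_induction_on with
    | _ m ih =>
      intro u hum
      have hu := (Finset.mem_filter.1 u.2)
      obtain ⟨G, hG, hlt⟩ := reduce_step hhom hN u.1 hu.2
      rw [mem_Mon.1 hu.1] at hG
      have h1 : π (monomial u.1 1) = Pi.single u 1 := by
        funext v
        rw [hπ, coeff_monomial, Pi.single_apply]
        by_cases huv : u = v
        · subst huv; simp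
        · rw [if_neg (fun h => huv (Subtype.ext h)), if_neg (fun h => huv h.symm)]
      have h2 : π (monomial u.1 1 - G) ∈ (Wsp (Ideal.span S) r D).map π := by
        rw [pi_eq_sum_univ' (π (monomial u.1 1 - G))]
        refine Submodule.sum_mem _ fun v _ => ?_
        by_cases h0 : coeff v.1 (monomial u.1 1 - G) = 0
        · rw [hπ, h0, zero_smul]; exact zero_mem _
        · refine Submodule.smul_mem _ _ ?_
          have := ih _ (by rw [← hum]; exact hlt _ h0) v rfl
          convert this using 1
      rw [map_sub, h1] at h2
      have h3 := add_mem h2 (Submodule.mem_map_of_mem (f := π) hG)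
      simpa using h3
  have htop : (Wsp (Ideal.span S) r D).map π = ⊤ := by
    rw [eq_top_iff]
    intro w _
    rw [pi_eq_sum_univ' w]
    refine Submodule.sum_mem _ fun v _ => Submodule.smul_mem _ _ ?_
    have := key _ v rfl
    convert this using 1
  have h1 := Submodule.finrank_map_le π (Wsp (Ideal.span S) r D)
  rw [htop, finrank_top, Module.finrank_fintype_fun_eq_card, Fintype.card_coe] at h1
  exact h1

/-- dimension is at most the number of leading exponents -/
lemma finrank_le_leads {n r D : ℕ} (I : Ideal (MvPolynomial (Fin (n + 1)) k))
    (ord : MonomialOrder (Fin (n + 1))) (L : Finset (Fin (n + 1) →₀ ℕ))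
    (hL : ∀ F ∈ Wsp I r D, F ≠ 0 → ord.degree F ∈ L) :
    Module.finrank k (Wsp I r D) ≤ L.card := by
  classical
  let π : MvPolynomial (Fin (n + 1)) k →ₗ[k] (L → k) := LinearMap.pi fun u => lcoeff k u.1
  have hπ : ∀ F u, π F u = coeff u.1 F := fun F u => rfl
  have hinj : Function.Injective (π.domRestrict (Wsp I r D)) := by
    rw [injective_iff_map_eq_zero]
    intro F hF
    by_contra h0
    have h1 : (F : MvPolynomial (Fin (n + 1)) k) ≠ 0 := fun h => h0 (Subtype.ext h)
    have h2 := congrFun hF ⟨_, hL F.1 F.2 h1⟩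
    exact (ord.coeff_degree_ne_zero_iff.2 h1) h2
  have := LinearMap.finrank_le_finrank_of_injective hinj
  rwa [Module.finrank_fintype_fun_eq_card, Fintype.card_coe] at this

/-- sum of the exponents other than `j` -/
def offdeg {n : ℕ} (j : Fin (n + 1)) (u : Fin (n + 1) →₀ ℕ) : ℕ := ∑ i, if i = j then 0 else u i

lemma offdeg_add {n : ℕ} (j : Fin (n + 1)) (u v : Fin (n + 1) →₀ ℕ) :
    offdeg j (u + v) = offdeg j u + offdeg j v := by
  unfold offdeg
  rw [← Finset.sum_add_distrib]
  refine Finset.sum_congr rfl fun i _ => ?_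
  split_ifs <;> simp

/-- ideal of polynomials of `offdeg`-order at least `s` -/
def offIdl (n : ℕ) (k : Type*) [Field k] (j : Fin (n + 1)) (s : ℕ) :
    Ideal (MvPolynomial (Fin (n + 1)) k) where
  carrier := {F | ∀ u, coeff u F ≠ 0 → s ≤ offdeg j u}
  zero_mem' := by intro u; simp
  add_mem' := by
    intro a b ha hb u hu
    rw [coeff_add] at hu
    by_cases h : coeff u a = 0
    · exact hb u (by intro h'; apply hu; rw [h, h', add_zero])
    · exact ha u h
  smul_mem' := by
    intro c F hF u hu
    rw [smul_eq_mul, coeff_mul] at hu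
    obtain ⟨⟨a, b⟩, hab, h⟩ := Finset.exists_ne_zero_of_sum_ne_zero hu
    rw [Finset.HasAntidiagonal.mem_antidiagonal] at hab
    have := hF b (right_ne_zero_of_mul h)
    rw [← hab]
    simp only [offdeg_add]
    omega

lemma offIdl_mul_mem {n s t : ℕ} {j : Fin (n + 1)} {F G : MvPolynomial (Fin (n + 1)) k}
    (hF : F ∈ offIdl n k j s) (hG : G ∈ offIdl n k j t) : F * G ∈ offIdl n k j (s + t) := by
  intro u hu
  rw [coeff_mul] at hu
  obtain ⟨⟨a, b⟩, hab, h⟩ := Finset.exists_ne_zero_of_sum_ne_zero hu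
  rw [Finset.HasAntidiagonal.mem_antidiagonal] at hab
  have h1 := hF a (left_ne_zero_of_mul h)
  have h2 := hG b (right_ne_zero_of_mul h)
  rw [← hab]
  simp only [offdeg_add]
  omega

lemma offIdl_pow {n : ℕ} (j : Fin (n + 1)) (r : ℕ) : (offIdl n k j 1) ^ r ≤ offIdl n k j r := by
  induction r with
  | zero => intro F _ u _; exact Nat.zero_le _
  | succ r ih =>
    rw [pow_succ, Ideal.mul_le]
    intro a ha b hb
    exact offIdl_mul_mem (ih ha) hb

lemma le_offIdl {n d : ℕ} {S : Set (MvPolynomial (Fin (n + 1)) k)}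
    (hhom : ∀ f ∈ S, f.IsHomogeneous d) (j : Fin (n + 1))
    (h0 : ∀ f ∈ S, coeff (Finsupp.single j d) f = 0) : Ideal.span S ≤ offIdl n k j 1 := by
  rw [Ideal.span_le]
  intro f hf u hu
  by_contra H
  have H1 : offdeg j u = 0 := by omega
  have H2 : ∀ i, i ≠ j → u i = 0 := by
    intro i hi
    unfold offdeg at H1
    rw [Finset.sum_eq_zero_iff] at H1
    have := H1 i (Finset.mem_univ _)
    rwa [if_neg hi] at this
  have h1 := (wHom_top_iff _ _).2 (hhom f hf) u hu
  rw [xdeg_top, Finset.sum_eq_single j (fun i _ hi => H2 i hi) (by simp)] at h1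
  apply hu
  have : u = Finsupp.single j d := by
    ext i
    by_cases hi : i = j
    · subst hi; simp [h1]
    · simp [H2 i hi, hi]
  rw [this]; exact h0 f hf

/-- The largest power of `I` containing an element with leading exponent `u`. -/
def phi {n : ℕ} (I : Ideal (MvPolynomial (Fin (n + 1)) k)) (ord : MonomialOrder (Fin (n + 1)))
    (u : Fin (n + 1) →₀ ℕ) : ℕ :=
  sSup {r | ∃ F ∈ I ^ r, F ≠ 0 ∧ ord.degree F = u}

lemma pow_bound {n d r : ℕ} {I : Ideal (MvPolynomial (Fin (n + 1)) k)}
    {ord : MonomialOrder (Fin (n + 1))} (hI : I ≤ ordIdl n k (n + 1) d)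
    {F : MvPolynomial (Fin (n + 1)) k} (hF : F ∈ I ^ r) (hF0 : F ≠ 0) :
    d * r ≤ ∑ i, ord.degree F i := by
  have hc : coeff (ord.degree F) F ≠ 0 := by rwa [ord.coeff_degree_ne_zero_iff]
  have h1 := Ideal.pow_right_mono hI r hF
  rw [← varIdeal_pow, ← pow_mul, varIdeal_pow] at h1
  have := h1 _ hc
  rwa [xdeg_top] at this

lemma phi_bdd {n d : ℕ} {I : Ideal (MvPolynomial (Fin (n + 1)) k)}
    (ord : MonomialOrder (Fin (n + 1))) (hd : 0 < d) (hI : I ≤ ordIdl n k (n + 1) d)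
    (u : Fin (n + 1) →₀ ℕ) : BddAbove {r | ∃ F ∈ I ^ r, F ≠ 0 ∧ ord.degree F = u} := by
  refine ⟨∑ i, u i, ?_⟩
  rintro r ⟨F, hF, hF0, rfl⟩
  have := pow_bound (ord := ord) hI hF hF0
  nlinarith

lemma phi_spec {n d : ℕ} {I : Ideal (MvPolynomial (Fin (n + 1)) k)}
    (ord : MonomialOrder (Fin (n + 1))) (hd : 0 < d) (hI : I ≤ ordIdl n k (n + 1) d)
    (u : Fin (n + 1) →₀ ℕ) : ∃ F ∈ I ^ (phi I ord u), F ≠ 0 ∧ ord.degree F = u := by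
  classical
  refine Nat.sSup_mem (s := {r | ∃ F ∈ I ^ r, F ≠ 0 ∧ ord.degree F = u}) ?_ (phi_bdd ord hd hI u)
  refine ⟨0, monomial u 1, by simp, by simp, ?_⟩
  rw [MonomialOrder.degree_monomial, if_neg one_ne_zero]

lemma le_phi {n d r : ℕ} {I : Ideal (MvPolynomial (Fin (n + 1)) k)}
    (ord : MonomialOrder (Fin (n + 1))) (hd : 0 < d) (hI : I ≤ ordIdl n k (n + 1) d)
    {F : MvPolynomial (Fin (n + 1)) k} (hF : F ∈ I ^ r) (hF0 : F ≠ 0) :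
    r ≤ phi I ord (ord.degree F) :=
  le_csSup (phi_bdd ord hd hI _) ⟨F, hF, hF0, rfl⟩

lemma phi_le_deg {n d : ℕ} {I : Ideal (MvPolynomial (Fin (n + 1)) k)}
    (ord : MonomialOrder (Fin (n + 1))) (hd : 0 < d) (hI : I ≤ ordIdl n k (n + 1) d)
    (u : Fin (n + 1) →₀ ℕ) : d * phi I ord u ≤ ∑ i, u i := by
  obtain ⟨F, hF, hF0, h⟩ := phi_spec ord hd hI u
  have := pow_bound (ord := ord) hI hF hF0
  rwa [h] at this

lemma phi_le_off {n d : ℕ} {I : Ideal (MvPolynomial (Fin (n + 1)) k)}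
    (ord : MonomialOrder (Fin (n + 1))) (hd : 0 < d) (hI : I ≤ ordIdl n k (n + 1) d)
    {j : Fin (n + 1)} (hj : I ≤ offIdl n k j 1)
    (u : Fin (n + 1) →₀ ℕ) : phi I ord u ≤ offdeg j u := by
  obtain ⟨F, hF, hF0, h⟩ := phi_spec ord hd hI u
  have hc : coeff (ord.degree F) F ≠ 0 := by rwa [ord.coeff_degree_ne_zero_iff]
  have := offIdl_pow j _ (Ideal.pow_right_mono hj _ hF) _ hc
  rwa [h] at this

/-- common coordinate sum -/
def Tsum (n D : ℕ) (i : Fin (n + 1)) : ℕ := ∑ u ∈ Mon n D, u i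

lemma Tsum_eq {n D : ℕ} (i j : Fin (n + 1)) : Tsum n D i = Tsum n D j := by
  classical
  unfold Tsum
  refine Finset.sum_nbij' (fun u => u.equivMapDomain (Equiv.swap i j))
    (fun u => u.equivMapDomain (Equiv.swap i j)) ?_ ?_ ?_ ?_ ?_
  · intro u hu
    rw [mem_Mon] at *
    simp only [Finsupp.equivMapDomain_apply]
    rw [← hu]
    exact Equiv.sum_comp (Equiv.swap i j).symm u
  · intro u hu
    rw [mem_Mon] at *
    simp only [Finsupp.equivMapDomain_apply]
    rw [← hu]
    exact Equiv.sum_comp (Equiv.swap i j).symm u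
  · intro u _; ext l; simp [Finsupp.equivMapDomain_apply]
  · intro u _; ext l; simp [Finsupp.equivMapDomain_apply]
  · intro u _; simp [Finsupp.equivMapDomain_apply]

lemma Tsum_mul {n D : ℕ} (i : Fin (n + 1)) : (n + 1) * Tsum n D i = D * (Mon n D).card := by
  have h1 : ∑ j : Fin (n + 1), Tsum n D j = (n + 1) * Tsum n D i := by
    rw [Finset.sum_congr rfl (fun j _ => Tsum_eq j i)]; simp
  rw [← h1]
  unfold Tsum
  rw [Finset.sum_comm, Finset.sum_congr rfl (fun u hu => mem_Mon.1 hu)]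
  simp [mul_comm]

lemma card_lt_filter {n h : ℕ} (hn : h ≤ n + 1) :
    (Finset.univ.filter fun i : Fin (n + 1) => (i : ℕ) < h).card = h := by
  rw [Fin.card_filter_val_lt]
  omega

lemma sum_xdeg {n h D : ℕ} (hn : h ≤ n + 1) (i : Fin (n + 1)) :
    ∑ u ∈ Mon n D, xdeg h u = h * Tsum n D i := by
  simp only [xdeg_eq]
  rw [Finset.sum_comm]
  have : ∀ j : Fin (n + 1), (∑ u ∈ Mon n D, if (j : ℕ) < h then u j else 0) =
      if (j : ℕ) < h then Tsum n D i else 0 := by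
    intro j
    split_ifs
    · exact Tsum_eq j i
    · simp
  simp only [this]
  rw [← Finset.sum_filter, Finset.sum_const, card_lt_filter hn, smul_eq_mul]

lemma phi_sum {n h d N D : ℕ} {I : Ideal (MvPolynomial (Fin (n + 1)) k)}
    (ord : MonomialOrder (Fin (n + 1))) (hd : 0 < d) (hI : I ≤ ordIdl n k (n + 1) d)
    (hn : h ≤ n + 1)
    (hW : ∀ r D, ((Mon n D).filter fun u => d * r + N ≤ xdeg h u).card ≤
      Module.finrank k (Wsp I r D)) (i : Fin (n + 1)) :
    h * Tsum n D i ≤ d * ∑ u ∈ Mon n D, phi I ord u + (N + d) * (Mon n D).card := by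
  classical
  have h1 : ∀ r, ((Mon n D).filter fun u => d * r + N ≤ xdeg h u).card ≤
      ((Mon n D).filter fun u => r ≤ phi I ord u).card := by
    intro r
    refine (hW r D).trans (finrank_le_leads I ord _ ?_)
    intro F hF hF0
    rw [mem_Wsp] at hF
    rw [Finset.mem_filter]
    refine ⟨?_, le_phi ord hd hI hF.1 hF0⟩
    rw [mem_Mon, ← xdeg_top]
    exact (wHom_top_iff _ _).2 hF.2 _ (ord.coeff_degree_ne_zero_iff.2 hF0)
  have h2 : ∑ r ∈ Finset.Icc 1 D, ((Mon n D).filter fun u => d * r + N ≤ xdeg h u).card ≤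
      ∑ r ∈ Finset.Icc 1 D, ((Mon n D).filter fun u => r ≤ phi I ord u).card :=
    Finset.sum_le_sum fun r _ => h1 r
  simp only [Finset.card_filter] at h2
  rw [Finset.sum_comm, Finset.sum_comm (s := Finset.Icc 1 D)] at h2
  simp only [← Finset.card_filter] at h2
  have h3 : ∑ u ∈ Mon n D, ((Finset.Icc 1 D).filter fun r => r ≤ phi I ord u).card ≤
      ∑ u ∈ Mon n D, phi I ord u := by
    refine Finset.sum_le_sum fun u _ => ?_
    have : (Finset.Icc 1 D).filter (fun r => r ≤ phi I ord u) ⊆ Finset.Icc 1 (phi I ord u) := by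
      intro r hr
      rw [Finset.mem_filter, Finset.mem_Icc] at hr
      rw [Finset.mem_Icc]; omega
    simpa using Finset.card_le_card this
  have h4 : ∑ u ∈ Mon n D, xdeg h u ≤
      ∑ u ∈ Mon n D, (d * ((Finset.Icc 1 D).filter fun r => d * r + N ≤ xdeg h u).card + (N + d)) := by
    refine Finset.sum_le_sum fun u hu => ?_
    have hx : xdeg h u ≤ D := by
      rw [← mem_Mon.1 hu, ← xdeg_top]; exact xdeg_le_top u
    have h5 : Finset.Icc 1 ((xdeg h u - N) / d) ⊆
        (Finset.Icc 1 D).filter fun r => d * r + N ≤ xdeg h u := by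
      intro r hr
      rw [Finset.mem_Icc] at hr
      have h6 : d * r ≤ xdeg h u - N := by
        have := (Nat.le_div_iff_mul_le hd).1 hr.2
        rwa [mul_comm] at this
      have h7 : 1 ≤ d * r := Nat.mul_pos hd hr.1
      have h8 : r ≤ d * r := Nat.le_mul_of_pos_left r hd
      rw [Finset.mem_filter, Finset.mem_Icc]
      omega
    have h6 := Finset.card_le_card h5
    rw [Nat.card_Icc, Nat.add_sub_cancel] at h6
    have h7 := Nat.mul_le_mul_left d h6
    have h8 := Nat.div_add_mod (xdeg h u - N) d
    have h9 := Nat.mod_lt (xdeg h u - N) hd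
    omega
  rw [sum_xdeg hn i, Finset.sum_add_distrib, ← Finset.mul_sum, Finset.sum_const, smul_eq_mul] at h4
  have h5 := Nat.mul_le_mul_left d (h2.trans h3)
  rw [mul_comm (Finset.card _) (N + d)] at h4
  omega

lemma card_Mon (n D : ℕ) : (Mon n D).card = (D + n).choose n := by
  unfold Mon
  have h1 := Finset.card_finsuppAntidiag_nat_eq_choose (s := (Finset.univ : Finset (Fin (n + 1)))) D
  rw [h1, Finset.card_univ, Fintype.card_fin]
  have h2 : n + 1 + D - 1 = D + n := by omega
  rw [h2, Nat.choose_symm_add]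

lemma card_Mon_mul (n K E : ℕ) (hK : 1 ≤ K) : (Mon n (K * E)).card ≤ K ^ n * (Mon n E).card := by
  rw [card_Mon, card_Mon]
  have h1 := Nat.ascFactorial_eq_factorial_mul_choose (K * E) n
  have h2 := Nat.ascFactorial_eq_factorial_mul_choose E n
  have h3 : (K * E + 1).ascFactorial n ≤ K ^ n * (E + 1).ascFactorial n := by
    rw [Nat.ascFactorial_eq_prod_range, Nat.ascFactorial_eq_prod_range]
    have : K ^ n = ∏ _i ∈ Finset.range n, K := by simp
    rw [this, ← Finset.prod_mul_distrib]
    refine Finset.prod_le_prod' fun i _ => ?_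
    nlinarith
  rw [h1, h2] at h3
  have h4 := Nat.factorial_pos n
  have h5 : n.factorial * (K * E + n).choose n ≤ n.factorial * (K ^ n * (E + n).choose n) := by
    calc _ ≤ _ := h3
      _ = _ := by ring
  exact Nat.le_of_mul_le_mul_left h5 h4

/-- a spike above `u` -/
def spk {n : ℕ} (u : Fin (n + 1) →₀ ℕ) (a : ℕ) (j : Fin (n + 1)) : Fin (n + 1) →₀ ℕ :=
  u + Finsupp.single j a

lemma spk_apply {n : ℕ} (u : Fin (n + 1) →₀ ℕ) (a : ℕ) (j i : Fin (n + 1)) :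
    spk u a j i = u i + if j = i then a else 0 := by
  classical
  simp [spk, Finsupp.single_apply]

lemma spk_deg {n : ℕ} (u : Fin (n + 1) →₀ ℕ) (a : ℕ) (j : Fin (n + 1)) :
    ∑ i, spk u a j i = ∑ i, u i + a := by
  classical
  simp only [spk_apply, Finset.sum_add_distrib]
  simp

lemma le_of_mem_Mon {n E : ℕ} {u : Fin (n + 1) →₀ ℕ} (hu : u ∈ Mon n E) (i : Fin (n + 1)) :
    u i ≤ E := by
  rw [← mem_Mon.1 hu]
  exact Finset.single_le_sum (f := fun i => u i) (fun _ _ => Nat.zero_le _) (Finset.mem_univ i)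

lemma spk_inj {n E a : ℕ} (hE : E < a) {u v : Fin (n + 1) →₀ ℕ} 
    (hv : v ∈ Mon n E) {i j : Fin (n + 1)} (h : spk u a i = spk v a j) : u = v ∧ i = j := by
  classical
  have hij : i = j := by
    by_contra H
    have h1 := DFunLike.congr_fun h i
    rw [spk_apply, spk_apply, if_pos rfl, if_neg (fun h => H h.symm)] at h1
    have := le_of_mem_Mon hv i
    omega
  subst hij
  exact ⟨add_right_cancel h, rfl⟩

lemma prod_mem_pow {R : Type*} [CommRing R] {ι : Type*} (I : Ideal R) (s : Finset ι) (e : ι → ℕ)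
    (F : ι → R) (hF : ∀ i ∈ s, F i ∈ I ^ e i) : ∏ i ∈ s, F i ∈ I ^ (∑ i ∈ s, e i) := by
  rw [← Finset.prod_pow_eq_pow_sum]
  exact Ideal.prod_mem_prod hF

lemma jensen {n h d N K E : ℕ} {I : Ideal (MvPolynomial (Fin (n + 1)) k)}
    (ord : MonomialOrder (Fin (n + 1))) (hd : 0 < d) (hI : I ≤ ordIdl n k (n + 1) d)
    (hn : h ≤ n + 1) (hU : hypU d h I ord)
    (hW : ∀ r D, ((Mon n D).filter fun u => d * r + N ≤ xdeg h u).card ≤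
      Module.finrank k (Wsp I r D)) (hK : 3 ≤ K) (hE : 1 ≤ E) :
    ∃ u ∈ Mon n E, h * (K * E) ≤
      d * ∑ j, phi I ord (spk u (K * E - E) j) + (N + d) * K ^ n := by
  classical
  set D := K * E with hD
  have hDE : 3 * E ≤ D := Nat.mul_le_mul_right E hK
  let P : Finset ((Fin (n + 1) →₀ ℕ) × Fin (n + 1)) := Mon n E ×ˢ Finset.univ
  let g : (Fin (n + 1) →₀ ℕ) × Fin (n + 1) → (Fin (n + 1) →₀ ℕ) := fun x => spk x.1 (D - E) x.2
  have hg : Set.InjOn g P := by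
    rintro ⟨u, i⟩ hu ⟨v, j⟩ hv huv
    have hv1 : v ∈ Mon n E := (Finset.mem_product.1 (Finset.mem_coe.1 hv)).1
    obtain ⟨h1, h2⟩ := spk_inj (by omega) hv1 huv
    exact Prod.ext h1 h2
  let U := P.image g
  have hUsub : U ⊆ Mon n D := by
    intro w hw
    obtain ⟨⟨u, i⟩, hu, rfl⟩ := Finset.mem_image.1 hw
    have hu1 : u ∈ Mon n E := (Finset.mem_product.1 hu).1
    rw [mem_Mon, spk_deg, mem_Mon.1 hu1]
    omega
  have hUsum : ∀ f : (Fin (n + 1) →₀ ℕ) → ℕ,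
      ∑ w ∈ U, f w = ∑ u ∈ Mon n E, ∑ j, f (spk u (D - E) j) := by
    intro f
    rw [Finset.sum_image hg, Finset.sum_product]
  have hUi : ∀ i : Fin (n + 1), ∑ w ∈ U, w i = D * (Mon n E).card := by
    intro i
    rw [hUsum (fun w => w i)]
    simp only [spk_apply, Finset.sum_add_distrib]
    have h1 : ∑ u ∈ Mon n E, ∑ _j : Fin (n + 1), u i = E * (Mon n E).card := by
      rw [← Tsum_mul i]
      simp [Tsum, Finset.mul_sum]
    rw [h1]
    simp only [Finset.sum_ite_eq', Finset.mem_univ, if_true, Finset.sum_const, smul_eq_mul]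
    rw [mul_comm _ (D - E), ← Nat.add_mul]
    congr 1; omega
  choose F hF hF0 hFd using phi_spec ord hd hI
  have i0 : Fin (n + 1) := 0
  have hTU : ∀ i, ∑ w ∈ Mon n D \ U, w i + D * (Mon n E).card = Tsum n D i0 := by
    intro i
    rw [← hUi i, Finset.sum_sdiff hUsub]
    exact Tsum_eq i i0
  have h1 := hU (∑ w ∈ Mon n D \ U, phi I ord w) (Tsum n D i0 - D * (Mon n E).card)
    (∏ w ∈ Mon n D \ U, F w) (prod_mem_pow I _ _ _ fun w _ => hF w)
    (Finset.prod_ne_zero_iff.2 fun w _ => hF0 w) (by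
      intro i
      rw [ord.degree_prod (fun w _ => hF0 w)]
      simp only [hFd]
      rw [Finsupp.finsetSum_apply]
      have := hTU i
      omega)
  have h2 := phi_sum (D := D) ord hd hI hn hW i0
  have h3 := Finset.sum_sdiff hUsub (f := phi I ord)
  have h4 := hTU i0
  have h5 : h * (D * (Mon n E).card) ≤ d * ∑ w ∈ U, phi I ord w + (N + d) * (Mon n D).card := by
    have h6 : h * (Tsum n D i0 - D * (Mon n E).card) + h * (D * (Mon n E).card) = h * Tsum n D i0 := by
      rw [← Nat.mul_add]; congr 1; omega
    rw [← h3, Nat.mul_add] at h2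
    rw [mul_comm _ d] at h1
    omega
  rw [hUsum] at h5
  have h6 : (N + d) * (Mon n D).card ≤ (N + d) * (K ^ n * (Mon n E).card) :=
    Nat.mul_le_mul_left _ (card_Mon_mul n K E (by omega))
  have h7 : ∑ _u ∈ Mon n E, h * D ≤ ∑ u ∈ Mon n E,
      (d * ∑ j, phi I ord (spk u (D - E) j) + (N + d) * K ^ n) := by
    simp only [Finset.sum_add_distrib, ← Finset.mul_sum, Finset.sum_const, smul_eq_mul]
    calc h * ((Mon n E).card * D) = h * (D * (Mon n E).card) := by ring
      _ ≤ _ := h5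
      _ ≤ d * ∑ u ∈ Mon n E, ∑ j, phi I ord (spk u (D - E) j) + (N + d) * (K ^ n * (Mon n E).card) := by
        omega
      _ = _ := by ring
  have hne : (Mon n E).Nonempty := by
    refine ⟨Finsupp.single i0 E, ?_⟩
    rw [mem_Mon]; simp
  exact Finset.exists_le_of_sum_le hne h7

/-- the lexicographic order in which later variables are larger -/
def revLex (n : ℕ) : MonomialOrder (Fin (n + 1)) where
  syn := (MonomialOrder.lex (σ := Fin (n + 1))).syn
  toSyn := (Finsupp.domCongr Fin.revPerm).trans (MonomialOrder.lex (σ := Fin (n + 1))).toSyn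
  toSyn_monotone := by
    intro u v huv
    have h1 : Finsupp.equivMapDomain Fin.revPerm u ≤ Finsupp.equivMapDomain Fin.revPerm v := by
      intro i
      rw [Finsupp.equivMapDomain_apply, Finsupp.equivMapDomain_apply]
      exact huv _
    exact (MonomialOrder.lex (σ := Fin (n + 1))).toSyn_monotone h1

lemma revLex_lt {n : ℕ} {u v : Fin (n + 1) →₀ ℕ} (j : Fin (n + 1))
    (h1 : ∀ i, j < i → u i = v i) (h2 : u j < v j) : (revLex n).toSyn u < (revLex n).toSyn v := by
  change toLex (Finsupp.domCongr Fin.revPerm u) < toLex (Finsupp.domCongr Fin.revPerm v)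
  rw [Finsupp.Lex.lt_iff]
  refine ⟨Fin.rev j, ?_, ?_⟩
  · intro i hi
    change Finsupp.equivMapDomain Fin.revPerm u i = Finsupp.equivMapDomain Fin.revPerm v i
    rw [Finsupp.equivMapDomain_apply, Finsupp.equivMapDomain_apply]
    apply h1
    simpa using Fin.lt_rev_iff.1 hi
  · change Finsupp.equivMapDomain Fin.revPerm u _ < Finsupp.equivMapDomain Fin.revPerm v _
    rw [Finsupp.equivMapDomain_apply, Finsupp.equivMapDomain_apply]
    simpa using h2

lemma wHom_of_lead {n h d : ℕ} {f : MvPolynomial (Fin (n + 1)) k} (hf : wHom (n + 1) f d)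
    (hl : f ≠ 0 → xdeg h ((revLex n).degree f) = d) : wHom h f d := by
  classical
  intro u hu
  have hf0 : f ≠ 0 := by rintro rfl; simp at hu
  have hv := hl hf0
  set v := (revLex n).degree f with hvdef
  have hvd : xdeg (n + 1) v = d := hf v ((revLex n).coeff_degree_ne_zero_iff.2 hf0)
  have hud : xdeg (n + 1) u = d := hf u hu
  have hle : (revLex n).toSyn u ≤ (revLex n).toSyn v :=
    (revLex n).le_degree (mem_support_iff.2 hu)
  have hzero : ∀ w : Fin (n + 1) →₀ ℕ, xdeg (n + 1) w = d →
      (xdeg h w = d ↔ ∀ i : Fin (n + 1), h ≤ (i : ℕ) → w i = 0) := by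
    intro w hw
    rw [← hw, xdeg_top, xdeg_eq, Finset.sum_eq_sum_iff_of_le (by intro i _; split_ifs <;> simp)]
    constructor
    · intro H i hi
      have := H i (Finset.mem_univ _)
      rw [if_neg (by omega)] at this
      exact this.symm
    · intro H i _
      split_ifs with hi
      · rfl
      · exact (H i (by omega)).symm
  have hv0 := (hzero v hvd).1 hv
  rw [hzero u hud]
  by_contra! H
  obtain ⟨i, hi, hui⟩ := H
  let B : Finset (Fin (n + 1)) := Finset.univ.filter fun i => h ≤ (i : ℕ) ∧ u i ≠ 0
  have hB : B.Nonempty := ⟨i, by simp [B, hi, hui]⟩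
  have hj := Finset.max'_mem B hB
  set j := B.max' hB
  have hj2 : h ≤ (j : ℕ) ∧ u j ≠ 0 := by simpa [B] using hj
  refine absurd (revLex_lt (u := v) (v := u) j ?_ ?_) (not_lt.2 hle)
  · intro i hji
    have hhi : h ≤ (i : ℕ) := hj2.1.trans (le_of_lt hji)
    rw [hv0 i hhi]
    by_contra hne
    have : i ∈ B := by simp [B, hhi, Ne.symm hne]
    exact absurd (Finset.le_max' B i this) (not_le.2 hji)
  · rw [hv0 j hj2.1]; omega

lemma phi_spk_le {n t d E a : ℕ} {I : Ideal (MvPolynomial (Fin (n + 1)) k)}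
    (ord : MonomialOrder (Fin (n + 1))) (hd : 0 < d) (hI : I ≤ ordIdl n k (n + 1) d)
    (hoff : ∀ j : Fin (n + 1), t ≤ (j : ℕ) → I ≤ offIdl n k j 1)
    {u : Fin (n + 1) →₀ ℕ} (hu : u ∈ Mon n E) (j : Fin (n + 1)) :
    d * phi I ord (spk u a j) ≤ (if (j : ℕ) < t then E + a else 0) + d * E := by
  split_ifs with hj
  · have := phi_le_deg ord hd hI (spk u a j)
    rw [spk_deg, mem_Mon.1 hu] at this
    omega
  · have h1 := phi_le_off ord hd hI (hoff j (by omega)) (spk u a j)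
    have h2 : offdeg j (spk u a j) ≤ E := by
      rw [← mem_Mon.1 hu]
      unfold offdeg
      refine Finset.sum_le_sum fun i _ => ?_
      split_ifs with hij
      · exact Nat.zero_le _
      · rw [spk_apply, if_neg (fun h => hij h.symm)]; simp
    rw [zero_add]
    exact Nat.mul_le_mul_left d (h1.trans h2)

lemma sum_ite_bound {n t D c : ℕ} (ht : t ≤ n + 1) :
    ∑ j : Fin (n + 1), ((if (j : ℕ) < t then D else 0) + c) = t * D + (n + 1) * c := by
  rw [Finset.sum_add_distrib, ← Finset.sum_filter, Finset.sum_const, card_lt_filter ht]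
  simp

lemma t_ge {n h t d N : ℕ} {I : Ideal (MvPolynomial (Fin (n + 1)) k)}
    (ord : MonomialOrder (Fin (n + 1))) (hd : 0 < d) (hI : I ≤ ordIdl n k (n + 1) d)
    (hn : h ≤ n + 1) (hU : hypU d h I ord)
    (hW : ∀ r D, ((Mon n D).filter fun u => d * r + N ≤ xdeg h u).card ≤
      Module.finrank k (Wsp I r D)) (ht : t ≤ n + 1)
    (hoff : ∀ j : Fin (n + 1), t ≤ (j : ℕ) → I ≤ offIdl n k j 1) : h ≤ t := by
  by_contra! H
  obtain ⟨K, hK⟩ : ∃ K, K = (n + 1) * d + 3 := ⟨_, rfl⟩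
  obtain ⟨C, hC⟩ : ∃ C, C = (N + d) * K ^ n := ⟨_, rfl⟩
  obtain ⟨E, hE⟩ : ∃ E, E = C + 1 := ⟨_, rfl⟩
  obtain ⟨u, hu, h1⟩ := jensen (K := K) (E := E) ord hd hI hn hU hW (by omega) (by omega)
  rw [← hC, Finset.mul_sum] at h1
  have h2 : ∑ j, d * phi I ord (spk u (K * E - E) j) ≤
      ∑ j : Fin (n + 1), ((if (j : ℕ) < t then E + (K * E - E) else 0) + d * E) :=
    Finset.sum_le_sum fun j _ => phi_spk_le ord hd hI hoff hu j
  rw [sum_ite_bound ht] at h2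
  have h3 : E ≤ K * E := Nat.le_mul_of_pos_left E (by omega)
  rw [Nat.add_sub_cancel' h3] at h2
  have h4 : (t + 1) * (K * E) ≤ h * (K * E) := Nat.mul_le_mul_right _ H
  have h5 : K * E ≤ (n + 1) * (d * E) + C := by nlinarith
  rw [hK] at h5
  nlinarith

lemma lead_xdeg {n h d N : ℕ} {I : Ideal (MvPolynomial (Fin (n + 1)) k)}
    (ord : MonomialOrder (Fin (n + 1))) (hd : 0 < d) (hI : I ≤ ordIdl n k (n + 1) d)
    (hn : h ≤ n + 1) (hU : hypU d h I ord)
    (hW : ∀ r D, ((Mon n D).filter fun u => d * r + N ≤ xdeg h u).card ≤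
      Module.finrank k (Wsp I r D))
    (hoff : ∀ j : Fin (n + 1), h ≤ (j : ℕ) → I ≤ offIdl n k j 1)
    {f : MvPolynomial (Fin (n + 1)) k} (hf : f ∈ I) (hfd : wHom (n + 1) f d) (hf0 : f ≠ 0) :
    xdeg h (ord.degree f) = d := by
  classical
  set v := ord.degree f with hv
  have hvd : xdeg (n + 1) v = d := hfd v (ord.coeff_degree_ne_zero_iff.2 hf0)
  have hle : xdeg h v ≤ d := hvd ▸ xdeg_le_top v
  by_contra hne
  have hlt : xdeg h v + 1 ≤ d := by omega
  obtain ⟨G, hG⟩ : ∃ G, G = (n + 1) * d + 1 := ⟨_, rfl⟩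
  obtain ⟨K, hK⟩ : ∃ K, K = h * d * G + d * h * h + 3 := ⟨_, rfl⟩
  obtain ⟨C, hC⟩ : ∃ C, C = (N + d) * K ^ n := ⟨_, rfl⟩
  obtain ⟨E, hE⟩ : ∃ E, E = C + 1 := ⟨_, rfl⟩
  obtain ⟨u, hu, h1⟩ := jensen (K := K) (E := E) ord hd hI hn hU hW (by omega) (by omega)
  have hEK : E ≤ K * E := Nat.le_mul_of_pos_left E (by omega)
  obtain ⟨D, hD⟩ : ∃ D, D = K * E := ⟨_, rfl⟩
  obtain ⟨a, ha⟩ : ∃ a, a = D - E := ⟨_, rfl⟩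
  rw [← hC, Finset.mul_sum, ← hD, ← ha] at h1
  have haD : E + a = D := by omega
  -- lower bound for every spike
  have hlow : ∀ i : Fin (n + 1), (i : ℕ) < h → D ≤ d * phi I ord (spk u a i) + G * E := by
    intro i hi
    have h2 : ∑ j ∈ Finset.univ.erase i, d * phi I ord (spk u a j) ≤
        ∑ j ∈ Finset.univ.erase i, ((if (j : ℕ) < h then E + a else 0) + d * E) :=
      Finset.sum_le_sum fun j _ => phi_spk_le ord hd hI hoff hu j
    have h3 := Finset.add_sum_erase Finset.univ (fun j => d * phi I ord (spk u a j)) (Finset.mem_univ i)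
    have h4 := Finset.add_sum_erase Finset.univ
      (fun j : Fin (n + 1) => ((if (j : ℕ) < h then E + a else 0) + d * E)) (Finset.mem_univ i)
    rw [sum_ite_bound hn] at h4
    simp only [hi, if_true] at h3 h4
    rw [haD] at h2 h4
    rw [hG]
    have h5 : ((n + 1) * d + 1) * E = (n + 1) * (d * E) + E := by ring
    rw [h5]
    omega
  choose F hF hF0 hFd using phi_spec ord hd hI
  set A : Finset (Fin (n + 1)) := Finset.univ.filter fun i => (i : ℕ) < h with hA
  have hAc : A.card = h := card_lt_filter hn
  have hvA : ∑ i ∈ A, v i = xdeg h v := by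
    rw [xdeg_eq, hA, Finset.sum_filter]
  have hvi : ∀ i, v i ≤ d := by
    intro i
    rw [xdeg_top] at hvd
    exact le_of_mem_Mon (mem_Mon.2 hvd) i
  have hsub : ∑ i ∈ A, (d - v i) + xdeg h v = h * d := by
    rw [← hvA, ← Finset.sum_add_distrib, ← hAc, Finset.sum_congr rfl (fun i _ => Nat.sub_add_cancel (hvi i))]
    simp
  have key := hU (1 * D + ∑ i ∈ A, phi I ord (spk u a i) * (d - v i)) (d * D + h * (d * E))
    (f ^ D * ∏ i ∈ A, F (spk u a i) ^ (d - v i)) (by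
      rw [pow_add]
      refine Ideal.mul_mem_mul ?_ (prod_mem_pow I _ _ _ fun i _ => ?_)
      · rw [one_mul]; exact Ideal.pow_mem_pow hf D
      · rw [pow_mul]; exact Ideal.pow_mem_pow (hF _) _)
    (mul_ne_zero (pow_ne_zero _ hf0) (Finset.prod_ne_zero_iff.2 fun i _ => pow_ne_zero _ (hF0 _)))
    (by
      intro l
      rw [ord.degree_mul (pow_ne_zero _ hf0)
        (Finset.prod_ne_zero_iff.2 fun i _ => pow_ne_zero _ (hF0 _)), ord.degree_pow,
        ord.degree_prod (fun i _ => pow_ne_zero _ (hF0 _))]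
      simp only [ord.degree_pow, hFd, ← hv]
      rw [Finsupp.add_apply, Finsupp.finsetSum_apply]
      simp only [Finsupp.smul_apply, smul_eq_mul, spk_apply, Nat.mul_add, Finset.sum_add_distrib]
      have e1 : ∑ i ∈ A, (d - v i) * u l ≤ h * (d * E) := by
        calc _ ≤ ∑ _i ∈ A, d * E := Finset.sum_le_sum fun i _ =>
              Nat.mul_le_mul (Nat.sub_le _ _) (le_of_mem_Mon hu l)
          _ = _ := by rw [Finset.sum_const, hAc, smul_eq_mul]
      have e2 : ∑ i ∈ A, (d - v i) * (if i = l then a else 0) ≤ (d - v l) * D := by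
        calc _ ≤ ∑ i : Fin (n + 1), (d - v i) * (if i = l then a else 0) :=
              Finset.sum_le_sum_of_subset (Finset.subset_univ _)
          _ = (d - v l) * a := by
              rw [Finset.sum_eq_single l (by intro i _ hi; simp [hi]) (by simp)]; simp
          _ ≤ _ := Nat.mul_le_mul_left _ (by omega)
      have e3 : D * v l + (d - v l) * D = d * D := by
        rw [mul_comm D, ← Nat.add_mul, Nat.add_sub_cancel' (hvi l)]
      omega)
  have h6 : ∑ i ∈ A, (d - v i) * D ≤ ∑ i ∈ A, (d * (phi I ord (spk u a i) * (d - v i)) + d * (G * E)) := by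
    refine Finset.sum_le_sum fun i hi => ?_
    have hi2 : (i : ℕ) < h := (Finset.mem_filter.1 hi).2
    calc (d - v i) * D ≤ (d - v i) * (d * phi I ord (spk u a i) + G * E) :=
          Nat.mul_le_mul_left _ (hlow i hi2)
      _ = d * (phi I ord (spk u a i) * (d - v i)) + (d - v i) * (G * E) := by ring
      _ ≤ _ := Nat.add_le_add_left (Nat.mul_le_mul_right _ (Nat.sub_le _ _)) _
  rw [Finset.sum_add_distrib, ← Finset.mul_sum, ← Finset.sum_mul, Finset.sum_const, hAc, smul_eq_mul] at h6
  set Φ := ∑ i ∈ A, phi I ord (spk u a i) * (d - v i)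
  set Y := ∑ i ∈ A, (d - v i)
  -- now D ≤ (h d G + d h h) E
  have h7 : h * d + 1 ≤ Y + d := by omega
  have h8 : (h * d + 1) * D ≤ (Y + d) * D := Nat.mul_le_mul_right _ h7
  have h9 : D ≤ (h * d * G + d * h * h) * E := by nlinarith
  rw [hD, hK] at h9
  nlinarith

lemma map_coord_span {n : ℕ} (M : Matrix (Fin (n + 1)) (Fin (n + 1)) k)
    (S : Set (MvPolynomial (Fin (n + 1)) k)) :
    (Ideal.span S).map (coordChange M) = Ideal.span (coordChange M '' S) :=
  Ideal.map_span _ _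

lemma image_homog {n d : ℕ} (M : Matrix (Fin (n + 1)) (Fin (n + 1)) k)
    {S : Set (MvPolynomial (Fin (n + 1)) k)} (hhom : ∀ f ∈ S, f.IsHomogeneous d) :
    ∀ f ∈ coordChange M '' S, f.IsHomogeneous d := by
  rintro _ ⟨f, hf, rfl⟩
  exact coordChange_homog M (hhom f hf)

lemma span_le_ordIdl {n d : ℕ} {S : Set (MvPolynomial (Fin (n + 1)) k)}
    (hhom : ∀ f ∈ S, f.IsHomogeneous d) : Ideal.span S ≤ ordIdl n k (n + 1) d := by
  rw [Ideal.span_le]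
  intro f hf u hu
  exact ((wHom_top_iff _ _).2 (hhom f hf) u hu).ge

lemma height_bound {n d h : ℕ} {I : Ideal (MvPolynomial (Fin (n + 1)) k)}
    {S : Set (MvPolynomial (Fin (n + 1)) k)} (hgen : I = Ideal.span S)
    (hhom : ∀ f ∈ S, f.IsHomogeneous d) (hd : 0 < d)
    (hh : idealHeight I = (h : ℕ∞)) : h ≤ n + 1 := by
  refine h_le hh ?_
  rw [hgen, maxIdl_eq]
  have h1 := varIdeal_pow (n := n) (k := k) (n + 1) 1
  rw [pow_one] at h1
  rw [h1]
  exact (span_le_ordIdl hhom).trans (ordIdl_mono hd)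

lemma forward {n d h : ℕ} {p : ℕ} (hp : p.Prime) [CharP k p] [IsAlgClosed k]
    (I : Ideal (MvPolynomial (Fin (n + 1)) k)) (hI : I ≠ ⊥)
    (S : Set (MvPolynomial (Fin (n + 1)) k)) (hgen : I = Ideal.span S)
    (hhom : ∀ f ∈ S, f.IsHomogeneous d) (hd : 0 < d)
    (hh : idealHeight I = (h : ℕ∞))
    (hfpt : Tendsto (fun e : ℕ => (nuFn I (p ^ e) : ℝ) / (p : ℝ) ^ e) atTop
      (nhds ((h : ℝ) / d))) :
    ∃ M : Matrix (Fin (n + 1)) (Fin (n + 1)) k, IsUnit M.det ∧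
        intCl (I.map (coordChange M)) =
          (((varIdeal k h : Ideal (MvPolynomial (Fin (n + 1)) k)) ^ d :
            Ideal (MvPolynomial (Fin (n + 1)) k)) : Set (MvPolynomial (Fin (n + 1)) k)) := by
  have hn := height_bound hgen hhom hd hh
  obtain ⟨A, hA, N, hN⟩ := coordsA hgen hhom hh hn
  obtain ⟨M, hM, t, hth, htn, hrad, hcoef⟩ := coordsB (d := d) hh
  refine ⟨M, hM, ?_⟩
  have hgenA : I.map (coordChange A) = Ideal.span (coordChange A '' S) := by
    rw [hgen, map_coord_span]
  have hgenM : I.map (coordChange M) = Ideal.span (coordChange M '' S) := by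
    rw [hgen, map_coord_span]
  have hhomM := image_homog M hhom
  set J := I.map (coordChange M) with hJ
  have hW : ∀ r D, ((Mon n D).filter fun u => d * r + N ≤ xdeg h u).card ≤
      Module.finrank k (Wsp J r D) := by
    intro r D
    rw [hJ, Wsp_finrank_map M hM, ← Wsp_finrank_map A hA, hgenA]
    rw [hgenA] at hN
    exact count_le (image_homog A hhom) hN
  have hJo : J ≤ ordIdl n k (n + 1) d := by rw [hgenM]; exact span_le_ordIdl hhomM
  have hU : hypU d h J (revLex n) := by
    refine hypU_of hp J hd hJo ?_ _
    simp only [hJ, nuFn_map M hM]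
    exact hfpt
  have hoff : ∀ j : Fin (n + 1), t ≤ (j : ℕ) → J ≤ offIdl n k j 1 := by
    intro j hj
    rw [hgenM]
    refine le_offIdl hhomM j ?_
    rintro _ ⟨f, hf, rfl⟩
    exact hcoef f (by rw [hgen]; exact Ideal.subset_span hf) j hj (hhom f hf)
  have hht := t_ge (revLex n) hd hJo hn hU hW htn hoff
  obtain rfl : t = h := le_antisymm hth hht
  have hlead : ∀ f ∈ coordChange M '' S, f ≠ 0 → xdeg t ((revLex n).degree f) = d := by
    intro f hf hf0
    exact lead_xdeg (revLex n) hd hJo hn hU hW hoff (by rw [hgenM]; exact Ideal.subset_span hf)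
      ((wHom_top_iff _ _).2 (hhomM f hf)) hf0
  have hS : ∀ f ∈ coordChange M '' S, wHom t f d := fun f hf =>
    wHom_of_lead ((wHom_top_iff _ _).2 (hhomM f hf)) (hlead f hf)
  obtain ⟨m, hm⟩ := Ideal.exists_pow_le_of_le_radical_of_fg hrad (IsNoetherian.noetherian _)
  rw [varIdeal_pow] at hm
  refine finish J _ hgenM hS hm ?_ hd
  -- nonzero: there is a nonzero generator, so `0 < t`
  have ht0 : 0 < t := by
    by_contra H
    obtain rfl : t = 0 := by omega
    apply hI
    rw [hgen, Ideal.span_eq_bot]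
    intro f hf
    by_contra hf0
    have h1 : coordChange M f ≠ 0 := by
      intro h2
      apply hf0
      exact (coordEquiv M hM).injective (by rw [coordEquiv_apply, h2, map_zero])
    have h3 := hlead _ ⟨f, hf, rfl⟩ h1
    rw [xdeg_eq] at h3
    simp at h3
    omega
  intro hbot
  have h1 : (X 0 : MvPolynomial (Fin (n + 1)) k) ^ m ∈ ordIdl n k t m := by
    have := ordIdl_pow_mem (m := m) (X_mem_ordIdl (k := k) (0 : Fin (n + 1)) (by simpa using ht0))
    rwa [one_mul] at this
  rw [hbot, Ideal.mem_bot] at h1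
  exact pow_ne_zero m (X_ne_zero 0) h1

/-- Theorem A: `fpt(I) = h/d` iff `Ī = (x_0,…,x_{h-1})^d` up to change of coordinates. -/
theorem stmt17 {n d h : ℕ} {p : ℕ} (hp : p.Prime) [CharP k p] [IsAlgClosed k]
    (I : Ideal (MvPolynomial (Fin (n + 1)) k)) (hI : I ≠ ⊥)
    (S : Set (MvPolynomial (Fin (n + 1)) k)) (hgen : I = Ideal.span S)
    (hhom : ∀ f ∈ S, f.IsHomogeneous d) (hd : 0 < d)
    (hh : idealHeight I = (h : ℕ∞)) (c : ℝ)
    (hfpt : Tendsto (fun e : ℕ => (nuFn I (p ^ e) : ℝ) / (p : ℝ) ^ e) atTop (nhds c)) :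
    c = (h : ℝ) / d ↔
      ∃ M : Matrix (Fin (n + 1)) (Fin (n + 1)) k, IsUnit M.det ∧
        intCl (I.map (coordChange M)) =
          (((varIdeal k h : Ideal (MvPolynomial (Fin (n + 1)) k)) ^ d :
            Ideal (MvPolynomial (Fin (n + 1)) k)) : Set (MvPolynomial (Fin (n + 1)) k)) := by
  constructor
  · intro hc
    rw [hc] at hfpt
    exact forward hp I hI S hgen hhom hd hh hfpt
  · rintro ⟨M, hM, hcl⟩
    refine backward hp (I.map (coordChange M)) (coordChange M '' S) ?_ (image_homog M hhom) hd
      (height_bound hgen hhom hd hh) c ?_ hcl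
    · rw [hgen, map_coord_span]
    · simp only [nuFn_map M hM]
      exact hfpt
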